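/- For any well-ordered homogeneous (n−1)×n matrix of integers Q = (q_{ij}) with q_{ii} ≥ 0 for all i and max_i {q_{ii}} > 0 (i.e. any possible dHB matrix of a zero-dimensional subscheme of P^2), there exists an integer d_0 such that for every d ≥ d_0, a general plane curve of degree d contains a zero-dimensional subscheme whose dHB matrix is Q. -/

import Mathlib

open MvPolynomial Matrix

/-- `f` is a form of degree `m : ℤ` -/
def IsFormOfDeg {k : ℕ} (f : MvPolynomial (Fin k) ℂ) (m : ℤ) : Prop :=
  if m < 0 then f = 0 else f.IsHomogeneous m.toNat

def HasDegMatrix {k a b : ℕ} (N : Matrix (Fin a) (Fin b) (MvPolynomial (Fin k) ℂ))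
    (M : Matrix (Fin a) (Fin b) ℤ) : Prop :=
  ∀ i j, IsFormOfDeg (N i j) (M i j)

def IsHomogMatrix {a b : ℕ} (M : Matrix (Fin a) (Fin b) ℤ) : Prop :=
  ∀ (i i' : Fin a) (j j' : Fin b), i < i' → j < j' →
    M i j + M i' j' = M i j' + M i' j

def WellOrderedMatrix {a b : ℕ} (M : Matrix (Fin a) (Fin b) ℤ) : Prop :=
  (∀ (i i' : Fin a) (j : Fin b), i ≤ i' → M i' j ≤ M i j) ∧
  (∀ (i : Fin a) (j j' : Fin b), j ≤ j' → M i j ≤ M i j')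

/-- A property `P` holds for a general form of degree `d` in `k` variables. -/
def GeneralForm (k : ℕ) (d : ℤ) (P : MvPolynomial (Fin k) ℂ → Prop) : Prop :=
  ∃ Φ : MvPolynomial ((Fin k) →₀ ℕ) ℂ,
    (∃ f : MvPolynomial (Fin k) ℂ, IsFormOfDeg f d ∧ eval f.coeff Φ ≠ 0) ∧
    ∀ f : MvPolynomial (Fin k) ℂ, IsFormOfDeg f d → eval f.coeff Φ ≠ 0 → P f

noncomputable def minorsIdeal {k n : ℕ} (A : Matrix (Fin n) (Fin (n+1)) (MvPolynomial (Fin k) ℂ)) :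
    Ideal (MvPolynomial (Fin k) ℂ) :=
  Ideal.span (Set.range fun j : Fin (n+1) => (A.submatrix id j.succAbove).det)

def IsZeroDimIdeal (I : Ideal (MvPolynomial (Fin 3) ℂ)) : Prop :=
  ringKrullDim (MvPolynomial (Fin 3) ℂ ⧸ I) = 1

noncomputable def hilbFn (I : Ideal (MvPolynomial (Fin 3) ℂ)) (t : ℕ) : ℕ :=
  Module.finrank ℂ (homogeneousSubmodule (Fin 3) ℂ t) -
    Module.finrank ℂ
      (Submodule.restrictScalars ℂ I ⊓ homogeneousSubmodule (Fin 3) ℂ t : Submodule ℂ _)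

noncomputable def hilbFnZ (I : Ideal (MvPolynomial (Fin 3) ℂ)) (t : ℤ) : ℕ :=
  if t < 0 then 0 else hilbFn I t.toNat

def Cond2 {n : ℕ} (M : Matrix (Fin n) (Fin n) ℤ) : Prop :=
  ∀ (t : ℕ) (_ : 1 ≤ t) (h2 : t < n),
    M ⟨t, h2⟩ ⟨t - 1, by omega⟩ < 0 →
      ((∑ i : Fin (n - t), M ⟨t + i.1, by have := i.2; omega⟩ ⟨t + i.1, by have := i.2; omega⟩) = 0
        ∨ (∑ i : Fin (n - t), M ⟨t + i.1, by have := i.2; omega⟩ ⟨t + i.1, by have := i.2; omega⟩)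
            = ∑ i, M i i)

/-- A polynomial map that injects coordinate rings hits a nonempty principal open set. -/
theorem exists_principalOpen_of_injective {σ τ : Type*} [Finite σ] [Finite τ]
    (Ψ : τ → MvPolynomial σ ℂ) (hΨ : Function.Injective (aeval Ψ : MvPolynomial τ ℂ →ₐ[ℂ] _)) :
    ∃ Φ : MvPolynomial τ ℂ, Φ ≠ 0 ∧
      ∀ y : τ → ℂ, eval y Φ ≠ 0 → ∃ x : σ → ℂ, ∀ t, eval x (Ψ t) = y t := by
  set f : MvPolynomial τ ℂ →+* MvPolynomial σ ℂ := (aeval Ψ : MvPolynomial τ ℂ →ₐ[ℂ] _).toRingHom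
  have hf : f.FinitePresentation := by
    refine RingHom.FinitePresentation.of_finiteType.mp ?_
    refine RingHom.FiniteType.of_comp_finiteType (f := (C : ℂ →+* MvPolynomial τ ℂ)) ?_
    have : f.comp C = algebraMap ℂ (MvPolynomial σ ℂ) := by
      ext; simp [f, algebraMap_eq]
    rw [this, RingHom.finiteType_algebraMap]
    infer_instance
  obtain ⟨S, hS⟩ := PrimeSpectrum.exists_constructibleSetData_iff.mpr
    (PrimeSpectrum.isConstructible_range_comap hf)
  have hbot : (⟨⊥, Ideal.isPrime_bot⟩ : PrimeSpectrum (MvPolynomial τ ℂ)) ∈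
      Set.range (PrimeSpectrum.comap f) := by
    refine ⟨⟨⊥, Ideal.isPrime_bot⟩, PrimeSpectrum.ext ?_⟩
    exact (RingHom.injective_iff_ker_eq_bot f).mp hΨ
  rw [← hS] at hbot
  simp only [PrimeSpectrum.ConstructibleSetData.toSet, Set.mem_iUnion] at hbot
  obtain ⟨D, hD, hDg, hDf⟩ := hbot
  refine ⟨D.f, fun h => hDf (by simp [h]), fun y hy => ?_⟩
  have hmem : (⟨vanishingIdeal ℂ {y}, by
      have := (isMaximal_iff_eq_vanishingIdeal_singleton (I := vanishingIdeal ℂ {y})).2 ⟨y, rfl⟩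
      exact this.isPrime⟩ : PrimeSpectrum (MvPolynomial τ ℂ)) ∈
      Set.range (PrimeSpectrum.comap f) := by
    rw [← hS]
    simp only [PrimeSpectrum.ConstructibleSetData.toSet, Set.mem_iUnion]
    refine ⟨D, hD, ?_, ?_⟩
    · rw [PrimeSpectrum.mem_zeroLocus] at hDg ⊢
      exact fun a ha => by rw [Set.mem_singleton_iff.mp (hDg ha)]; exact Ideal.zero_mem _
    · rw [PrimeSpectrum.mem_zeroLocus]
      intro h
      have h1 := h (Set.mem_singleton _)
      simp only [SetLike.mem_coe, mem_vanishingIdeal_singleton_iff] at h1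
      exact hy h1
  obtain ⟨q, hq⟩ := hmem
  obtain ⟨m, hm, hqm⟩ := q.asIdeal.exists_le_maximal q.isPrime.ne_top
  obtain ⟨x, rfl⟩ := isMaximal_iff_eq_vanishingIdeal_singleton.1 hm
  refine ⟨x, fun t => ?_⟩
  have h1 : (X t - C (y t) : MvPolynomial τ ℂ) ∈ (PrimeSpectrum.comap f q).asIdeal := by
    rw [hq]
    simp
  have h2 := hqm (Ideal.mem_comap.mp h1)
  rw [mem_vanishingIdeal_singleton_iff] at h2
  have h3 : f (X t - C (y t)) = Ψ t - C (y t) := by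
    change aeval Ψ (X t - C (y t)) = _
    rw [map_sub, aeval_X, ← algebraMap_eq, AlgHom.commutes, algebraMap_eq]
  have h4 : eval x (f (X t - C (y t))) = 0 := h2
  rw [h3, map_sub, eval_C, sub_eq_zero] at h4
  exact h4

theorem eval_aeval_eq {σ τ : Type*} (Ψ : τ → MvPolynomial σ ℂ) (x : σ → ℂ)
    (P : MvPolynomial τ ℂ) : eval x (aeval Ψ P) = eval (fun t => eval x (Ψ t)) P := by
  induction P using MvPolynomial.induction_on with
  | C a => simp
  | add p q hp hq => rw [map_add, map_add, hp, hq, map_add]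
  | mul_X p i hp => rw [map_mul, map_mul, hp, map_mul, aeval_X, eval_X]

theorem contDiff_eval {σ : Type*} [Fintype σ] (p : MvPolynomial σ ℂ) :
    ContDiff ℂ 1 (fun x : σ → ℂ => eval x p) := by
  induction p using MvPolynomial.induction_on with
  | C a => simpa using contDiff_const
  | add p q hp hq => simpa using hp.add hq
  | mul_X p i hp => simpa using hp.mul (contDiff_apply ℂ ℂ i)

/-- A polynomial map whose differential at some point is surjective injects coordinate rings. -/
theorem aeval_injective_of_hasDerivAt {σ τ : Type*} [Finite σ] [Finite τ]
    (Ψ : τ → MvPolynomial σ ℂ) (x₀ : σ → ℂ)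
    (h : ∀ w : τ → ℂ, ∃ v : σ → ℂ, ∀ t,
      HasDerivAt (fun s : ℂ => eval (x₀ + s • v) (Ψ t)) (w t) 0) :
    Function.Injective (aeval Ψ : MvPolynomial τ ℂ →ₐ[ℂ] MvPolynomial σ ℂ) := by
  have := Fintype.ofFinite σ
  have := Fintype.ofFinite τ
  set G : (σ → ℂ) → (τ → ℂ) := fun x t => eval x (Ψ t)
  have hG : ContDiff ℂ 1 G := contDiff_pi.2 fun t => contDiff_eval (Ψ t)
  have hs : HasStrictFDerivAt G (fderiv ℂ G x₀) x₀ :=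
    hG.contDiffAt.hasStrictFDerivAt one_ne_zero
  have hsurj : (fderiv ℂ G x₀).range = ⊤ := by
    rw [LinearMap.range_eq_top]
    intro w
    obtain ⟨v, hv⟩ := h w
    refine ⟨v, ?_⟩
    have h1 : HasDerivAt (fun s : ℂ => G (x₀ + s • v)) w 0 := hasDerivAt_pi.2 hv
    have h2 : HasDerivAt (fun s : ℂ => x₀ + s • v) v 0 := by
      simpa using ((hasDerivAt_id (0 : ℂ)).smul_const v).const_add x₀
    have h3 : HasFDerivAt G (fderiv ℂ G x₀) (x₀ + (0 : ℂ) • v) := by simpa using hs.hasFDerivAt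
    have h4 := h3.comp_hasDerivAt (0 : ℂ) h2
    exact h4.unique h1
  have hmap := hs.map_nhds_eq_of_surj hsurj
  rw [injective_iff_map_eq_zero]
  intro P hP
  have hev : ∀ᶠ y in nhds (G x₀), eval y P = 0 := by
    rw [← hmap, Filter.eventually_map]
    refine Filter.Eventually.of_forall fun x => ?_
    rw [← eval_aeval_eq, hP, map_zero]
  obtain ⟨ε, hε, hball⟩ := Metric.eventually_nhds_iff.1 hev
  refine MvPolynomial.funext_set (fun i => Metric.ball (G x₀ i) ε)
    (fun i => infinite_of_mem_nhds _ (Metric.ball_mem_nhds _ hε)) fun y hy => ?_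
  rw [map_zero]
  exact hball ((dist_pi_lt_iff hε).2 fun i => hy i trivial)

theorem isFormOfDeg_natCast {k : ℕ} {f : MvPolynomial (Fin k) ℂ} {d : ℕ} :
    IsFormOfDeg f d ↔ f.IsHomogeneous d := by
  rw [IsFormOfDeg, if_neg (by omega), Int.toNat_natCast]

theorem hasDerivAt_coeff_eval {κ : Type*} (Q : Polynomial (MvPolynomial κ ℂ)) (m : κ →₀ ℕ) :
    HasDerivAt (fun s : ℂ => coeff m (Q.eval (C s))) (coeff m (Q.coeff 1)) 0 := by
  induction Q using Polynomial.induction_on' with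
  | add p q hp hq =>
    simp only [Polynomial.eval_add, Polynomial.coeff_add, coeff_add]
    exact hp.add hq
  | monomial n a =>
    have h : (fun s : ℂ => coeff m ((Polynomial.monomial n a).eval (C s))) =
        fun s => coeff m a * s ^ n := by
      ext s
      rw [Polynomial.eval_monomial, ← C_pow, mul_comm, coeff_C_mul, mul_comm]
    rw [h, Polynomial.coeff_monomial]
    have h1 := (hasDerivAt_pow n (0 : ℂ)).const_mul (coeff m a)
    have h2 : coeff m (if n = 1 then a else 0) = coeff m a * (n * 0 ^ (n - 1)) := by
      rcases n with _ | _ | n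
      · simp
      · simp
      · rw [if_neg (by omega)]
        simp
    rw [h2]
    exact h1

/-- A family of forms of degree `d`, depending polynomially on a finite-dimensional space `U` of
parameters and submersive at the origin, contains the general form of degree `d`. -/
theorem generalForm_of_submersion {k d : ℕ} {ι : Type*} [Finite ι]
    {P : MvPolynomial (Fin k) ℂ → Prop} (U : Submodule ℂ (ι → MvPolynomial (Fin k) ℂ))
    [FiniteDimensional ℂ U] (E : MvPolynomial ι (MvPolynomial (Fin k) ℂ))
    (hhom : ∀ u ∈ U, (eval u E).IsHomogeneous d) (hP : ∀ u ∈ U, P (eval u E))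
    (hsurj : ∀ G : MvPolynomial (Fin k) ℂ, G.IsHomogeneous d → ∃ u ∈ U,
      (eval₂ Polynomial.C (fun i => Polynomial.X * Polynomial.C (u i)) E).coeff 1 = G) :
    GeneralForm k d P := by
  classical
  have := Fintype.ofFinite ι
  let b := Module.finBasis ℂ U
  let n := Module.finrank ℂ U
  let pt : (Fin n → ℂ) → ι → MvPolynomial (Fin k) ℂ := fun x => ((∑ i, x i • b i : U) : ι → _)
  let Fg : MvPolynomial (Fin k) (MvPolynomial (Fin n) ℂ) :=
    eval₂ (MvPolynomial.map C) (fun j => ∑ i : Fin n, C (X i) * MvPolynomial.map C ((b i).1 j)) E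
  have hid : ∀ (x : Fin n → ℂ) (p : MvPolynomial (Fin k) ℂ),
      MvPolynomial.map (eval x) (MvPolynomial.map C p) = p := by
    intro x p
    have : (eval x).comp (C : ℂ →+* MvPolynomial (Fin n) ℂ) = RingHom.id ℂ := by ext; simp
    rw [MvPolynomial.map_map, this, MvPolynomial.map_id]
  have hFg : ∀ x, MvPolynomial.map (eval x) Fg = eval (pt x) E := by
    intro x
    simp only [Fg, ← coe_eval₂Hom]
    rw [← RingHom.comp_apply]
    congr 1
    refine MvPolynomial.ringHom_ext (fun p => ?_) (fun j => ?_)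
    · simp [hid]
    · simp [hid, pt, map_sum, Finset.sum_apply, smul_eq_C_mul]
  let τ := {m : Fin k →₀ ℕ // m.degree = d}
  have hτ : Finite τ := by
    have : {m : Fin k →₀ ℕ | m.degree = d}.Finite := by
      refine (Finset.finite_toSet (Finset.univ.finsuppAntidiag d)).subset fun m hm => ?_
      simp only [Finset.mem_coe, Finset.mem_finsuppAntidiag]
      exact ⟨by rw [← hm, Finsupp.degree_eq_sum], Finset.subset_univ _⟩
    exact this
  let Ψ : τ → MvPolynomial (Fin n) ℂ := fun m => coeff m.1 Fg
  have hΨ : ∀ x m, eval x (Ψ m) = coeff m.1 (eval (pt x) E) := by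
    intro x m
    rw [← hFg, coeff_map]
  have hform : ∀ y : τ → ℂ, ∃ G : MvPolynomial (Fin k) ℂ, G.IsHomogeneous d ∧
      ∀ m : τ, coeff m.1 G = y m := by
    intro y
    have := Fintype.ofFinite τ
    refine ⟨∑ m : τ, monomial m.1 (y m), ?_, fun m => ?_⟩
    · exact IsHomogeneous.sum _ _ _ fun m _ => isHomogeneous_monomial _ m.2
    · rw [coeff_sum, Finset.sum_eq_single m]
      · simp
      · intro i _ hi
        rw [coeff_monomial, if_neg fun h => hi (Subtype.ext h)]
      · simp
  have hinj := aeval_injective_of_hasDerivAt Ψ 0 (by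
    intro w
    obtain ⟨G, hG, hGw⟩ := hform w
    obtain ⟨u, hu, huG⟩ := hsurj G hG
    refine ⟨b.repr ⟨u, hu⟩, fun m => ?_⟩
    have key : ∀ s : ℂ, eval (0 + s • (b.repr ⟨u, hu⟩ : Fin n → ℂ)) (Ψ m) = coeff m.1
        ((eval₂ Polynomial.C (fun i => Polynomial.X * Polynomial.C (u i)) E).eval (C s)) := by
      intro s
      have hpt : pt (s • (b.repr ⟨u, hu⟩ : Fin n → ℂ)) = s • u := by
        simp only [pt, Pi.smul_apply, smul_eq_mul, mul_smul, ← Finset.smul_sum]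
        rw [b.sum_repr]
        rfl
      rw [zero_add, hΨ, hpt]
      congr 1
      rw [← Polynomial.coe_evalRingHom, ← coe_eval₂Hom, ← RingHom.comp_apply]
      congr 1
      refine MvPolynomial.ringHom_ext (fun p => ?_) (fun j => ?_)
      · rw [eval_C, RingHom.comp_apply, coe_eval₂Hom, eval₂_C, Polynomial.coe_evalRingHom,
          Polynomial.eval_C]
      · rw [eval_X, RingHom.comp_apply, coe_eval₂Hom, eval₂_X, Polynomial.coe_evalRingHom,
          Polynomial.eval_mul, Polynomial.eval_X, Polynomial.eval_C, Pi.smul_apply, smul_eq_C_mul]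
    simp_rw [key]
    rw [← hGw, ← huG]
    exact hasDerivAt_coeff_eval _ _)
  obtain ⟨Φ, hΦ, hΦP⟩ := exists_principalOpen_of_injective Ψ hinj
  have hcoe : ∀ f : MvPolynomial (Fin k) ℂ,
      eval f.coeff (rename Subtype.val Φ) = eval (fun m : τ => coeff m.1 f) Φ := by
    intro f
    rw [eval_rename]
    rfl
  refine ⟨rename Subtype.val Φ, ?_, fun f hf hne => ?_⟩
  · obtain ⟨y, hy⟩ : ∃ y, eval y Φ ≠ 0 := by
      by_contra! h
      exact hΦ (MvPolynomial.funext fun x => by rw [h, map_zero])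
    obtain ⟨G, hG, hGy⟩ := hform y
    refine ⟨G, isFormOfDeg_natCast.2 hG, ?_⟩
    rw [hcoe]
    simpa only [hGy] using hy
  · have hf' : f.IsHomogeneous d := isFormOfDeg_natCast.1 hf
    rw [hcoe] at hne
    obtain ⟨x, hx⟩ := hΦP _ hne
    have hmem : pt x ∈ U := (∑ i, x i • b i : U).2
    have : f = eval (pt x) E := by
      ext m
      by_cases hm : m.degree = d
      · rw [← hx ⟨m, hm⟩, hΨ]
      · rw [hf'.coeff_eq_zero hm, (hhom _ hmem).coeff_eq_zero hm]
    rw [this]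
    exact hP _ hmem

section Bidiagonal

variable {R : Type*} [CommRing R]

/-- The `k × (k + 1)` matrix with `P` on the diagonal, `Q` just above it and zeros elsewhere. -/
def bidiag {k : ℕ} (P Q : Fin k → R) : Matrix (Fin k) (Fin (k + 1)) R :=
  Matrix.of fun i j => if j = i.castSucc then P i else if j = i.succ then Q i else 0

theorem bidiag_succ_succ {k : ℕ} (P Q : Fin (k + 1) → R) (i : Fin k) (j : Fin (k + 1)) :
    bidiag P Q i.succ j.succ = bidiag (fun l => P l.succ) (fun l => Q l.succ) i j := by
  simp only [bidiag, Matrix.of_apply, ← Fin.succ_castSucc, Fin.succ_inj]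

theorem bidiag_succ_zero {k : ℕ} (P Q : Fin (k + 1) → R) (i : Fin k) :
    bidiag P Q i.succ 0 = 0 := by
  simp only [bidiag, Matrix.of_apply, ← Fin.succ_castSucc]
  rw [if_neg (Fin.succ_ne_zero _).symm, if_neg (Fin.succ_ne_zero _).symm]

theorem bidiag_zero_zero {k : ℕ} (P Q : Fin (k + 1) → R) : bidiag P Q 0 0 = P 0 := by
  simp [bidiag]

theorem bidiag_zero_succ {k : ℕ} (P Q : Fin (k + 1) → R) (j : Fin (k + 1)) :
    bidiag P Q 0 j.succ = if j = 0 then Q 0 else 0 := by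
  simp only [bidiag, Matrix.of_apply, Fin.castSucc_zero, Fin.succ_ne_zero, if_false, Fin.succ_inj]

/-- The product of the first `c` entries of `P` and the remaining entries of `Q`. -/
def mixedProd {k : ℕ} (P Q : Fin k → R) (c : Fin (k + 1)) : R :=
  ∏ l, if l.castSucc < c then P l else Q l

theorem mixedProd_zero {k : ℕ} (P Q : Fin k → R) : mixedProd P Q 0 = ∏ l, Q l := by
  simp [mixedProd]

theorem mixedProd_last {k : ℕ} (P Q : Fin k → R) : mixedProd P Q (Fin.last k) = ∏ l, P l := by
  simp [mixedProd, Fin.castSucc_lt_last]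

theorem mixedProd_succ {k : ℕ} (P Q : Fin (k + 1) → R) (c : Fin (k + 1)) :
    mixedProd P Q c.succ = P 0 * mixedProd (fun l => P l.succ) (fun l => Q l.succ) c := by
  simp only [mixedProd, Fin.prod_univ_succ, ← Fin.succ_castSucc, Fin.succ_lt_succ_iff,
    Fin.castSucc_zero, Fin.succ_pos, if_true]

theorem det_bidiag_submatrix {k : ℕ} (P Q : Fin k → R) (c : Fin (k + 1)) :
    ((bidiag P Q).submatrix id c.succAbove).det = mixedProd P Q c := by
  induction k with
  | zero => simp [mixedProd]
  | succ k ih =>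
    induction c using Fin.cases with
    | zero =>
      rw [mixedProd_zero, Matrix.det_of_isLowerTriangular]
      · refine Finset.prod_congr rfl fun i _ => ?_
        simp [bidiag, Fin.ext_iff]
      · intro i j hij
        replace hij : i < j := hij
        have : (i : ℕ) < j := hij
        simp only [bidiag, Matrix.submatrix_apply, id, Matrix.of_apply, Fin.ext_iff,
          Fin.zero_succAbove, Fin.val_succ, Fin.val_castSucc]
        rw [if_neg (by omega), if_neg (by omega)]
    | succ c =>
      rw [Matrix.det_succ_column_zero, Fin.sum_univ_succ, Finset.sum_eq_zero, add_zero,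
        mixedProd_succ, ← ih]
      · simp only [Fin.val_zero, pow_zero, one_mul, Matrix.submatrix_apply, id,
          Fin.succ_succAbove_zero, bidiag_zero_zero]
        congr 2
        ext i j
        simp [bidiag_succ_succ]
      · intro i _
        simp [bidiag_succ_zero]

/-- The signed maximal minors of the bidiagonal matrix have only the obvious syzygies. -/
theorem exists_vecMul_bidiag_of_sum_eq_zero [IsDomain R] {k : ℕ} (P Q : Fin k → R)
    (hP : ∀ i, P i ≠ 0) (hPQ : ∀ i j t, P i ∣ Q j * t → P i ∣ t) (a : Fin (k + 1) → R)
    (h : ∑ c : Fin (k + 1), (-1) ^ (c : ℕ) * a c * mixedProd P Q c = 0) :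
    ∃ γ : Fin k → R, a = γ ᵥ* bidiag P Q := by
  induction k with
  | zero =>
    refine ⟨0, ?_⟩
    ext c
    fin_cases c
    simpa [mixedProd] using h
  | succ k ih =>
    have h0 : P 0 ∣ a 0 := by
      have h1 : P 0 ∣ (∏ l, Q l) * a 0 := by
        rw [Fin.sum_univ_succ] at h
        simp only [mixedProd_zero, mixedProd_succ, Fin.val_zero, pow_zero, one_mul] at h
        have : (∏ l, Q l) * a 0 = P 0 * (-∑ i : Fin (k + 1), (-1) ^ (i.succ : ℕ) * a i.succ *
            mixedProd (fun l => P l.succ) (fun l => Q l.succ) i) := by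
          rw [mul_neg, Finset.mul_sum, eq_neg_iff_add_eq_zero, mul_comm, ← h]
          congr 1
          exact Finset.sum_congr rfl fun i _ => by ring
        exact ⟨_, this⟩
      have : ∀ s : Finset (Fin (k + 1)), ∀ t, P 0 ∣ (∏ l ∈ s, Q l) * t → P 0 ∣ t := by
        intro s
        induction s using Finset.induction_on with
        | empty => intro t ht; simpa using ht
        | insert l s hl ihs =>
          intro t ht
          rw [Finset.prod_insert hl, mul_assoc] at ht
          exact ihs t (hPQ _ _ _ ht)
      exact this _ _ h1
    obtain ⟨g, hg⟩ := h0
    obtain ⟨γ, hγ⟩ := ih (fun l => P l.succ) (fun l => Q l.succ) (fun i => hP _)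
      (fun i j t => hPQ _ _ t) (fun c => a c.succ - if c = 0 then g * Q 0 else 0) (by
        rw [Fin.sum_univ_succ] at h ⊢
        rw [Fin.sum_univ_succ] at h
        simp only [mixedProd_zero, mixedProd_succ, Fin.val_zero, pow_zero, one_mul,
          Fin.succ_ne_zero, if_false, if_true, sub_zero] at h ⊢
        rw [Fin.prod_univ_succ] at h
        apply mul_left_cancel₀ (hP 0)
        rw [mul_zero, mul_add, Finset.mul_sum, ← neg_eq_zero, ← h, hg, neg_add,
          ← Finset.sum_neg_distrib, ← add_assoc]
        congr 1
        · simp; ring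
        · refine Finset.sum_congr rfl fun i _ => ?_
          simp only [Fin.val_succ, pow_succ]; ring)
    refine ⟨Fin.cons g γ, ?_⟩
    ext c
    rw [Matrix.vecMul, dotProduct, Fin.sum_univ_succ]
    induction c using Fin.cases with
    | zero => simp [bidiag_succ_zero, bidiag_zero_zero, hg, mul_comm]
    | succ c =>
      have := congrFun hγ c
      rw [Matrix.vecMul, dotProduct, sub_eq_iff_eq_add] at this
      rw [this]
      simp [bidiag_succ_succ, bidiag_zero_succ, add_comm]

end Bidiagonal

/-- The signed maximal minors are orthogonal to the row space. -/
theorem sum_vecMul_mul_minor {R : Type*} [CommRing R] {k : ℕ} (A : Matrix (Fin k) (Fin (k + 1)) R)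
    (γ : Fin k → R) :
    ∑ c : Fin (k + 1), (-1) ^ (c : ℕ) * (γ ᵥ* A) c * (A.submatrix id c.succAbove).det = 0 := by
  have key : ∀ i : Fin k, ∑ c : Fin (k + 1),
      (-1) ^ (c : ℕ) * A i c * (A.submatrix id c.succAbove).det = 0 := by
    intro i
    have h := Matrix.det_succ_row_zero (Matrix.of (Fin.cons (A i) A : Fin (k + 1) → _))
    rw [Matrix.det_zero_of_row_eq (Fin.succ_ne_zero i).symm] at h
    · exact h.symm
    · rfl
  have : ∀ c : Fin (k + 1), (-1) ^ (c : ℕ) * (γ ᵥ* A) c * (A.submatrix id c.succAbove).det =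
      ∑ i, γ i * ((-1) ^ (c : ℕ) * A i c * (A.submatrix id c.succAbove).det) := by
    intro c
    rw [Matrix.vecMul, dotProduct, Finset.mul_sum, Finset.sum_mul]
    exact Finset.sum_congr rfl fun i _ => by ring
  simp_rw [this]
  rw [Finset.sum_comm]
  simp_rw [← Finset.mul_sum, key, mul_zero, Finset.sum_const_zero]

section Dimension

/-- Restriction to the line `X 2 = 0`. -/
noncomputable def restrictLine :
    MvPolynomial (Fin 3) ℂ →ₐ[ℂ] MvPolynomial (Fin 3) ℂ :=
  aeval ![X 0, X 1, 0]

@[simp] theorem restrictLine_X_zero : restrictLine (X 0) = X 0 := by simp [restrictLine]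

@[simp] theorem restrictLine_X_one : restrictLine (X 1) = X 1 := by simp [restrictLine]

@[simp] theorem restrictLine_X_two : restrictLine (X 2) = 0 := by simp [restrictLine]

theorem X_two_dvd_sub_restrictLine (f : MvPolynomial (Fin 3) ℂ) :
    (X 2 : MvPolynomial (Fin 3) ℂ) ∣ f - restrictLine f := by
  rw [← Ideal.mem_span_singleton, ← Ideal.Quotient.mk_eq_mk_iff_sub_mem]
  have : (Ideal.Quotient.mkₐ ℂ (Ideal.span {(X 2 : MvPolynomial (Fin 3) ℂ)})) =
      (Ideal.Quotient.mkₐ ℂ (Ideal.span {(X 2 : MvPolynomial (Fin 3) ℂ)})).comp restrictLine := by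
    ext i
    fin_cases i
    · simp
    · simp
    · simp
  exact DFunLike.congr_fun this f

theorem constantCoeff_restrictLine (f : MvPolynomial (Fin 3) ℂ) :
    constantCoeff (restrictLine f) = constantCoeff f := by
  obtain ⟨g, hg⟩ := X_two_dvd_sub_restrictLine f
  have := congrArg constantCoeff hg
  rw [map_sub, map_mul, constantCoeff_X, zero_mul, sub_eq_zero] at this
  exact this.symm

theorem totalDegree_aeval_le {σ τ R : Type*} [CommSemiring R] (g : σ → MvPolynomial τ R)
    (hg : ∀ i, (g i).totalDegree ≤ 1) (f : MvPolynomial σ R) :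
    (aeval g f).totalDegree ≤ f.totalDegree := by
  rw [aeval_def, eval₂_eq]
  refine totalDegree_finsetSum_le fun m hm => ?_
  refine (totalDegree_mul _ _).trans ?_
  rw [MvPolynomial.algebraMap_eq, totalDegree_C, zero_add]
  refine (totalDegree_finsetProd _ _).trans (le_trans ?_ (le_totalDegree hm))
  refine Finset.sum_le_sum fun i _ => (totalDegree_pow _ _).trans ?_
  exact (Nat.mul_le_mul_left _ (hg i)).trans_eq (mul_one _)

theorem totalDegree_restrictLine_le (f : MvPolynomial (Fin 3) ℂ) :
    (restrictLine f).totalDegree ≤ f.totalDegree := by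
  refine totalDegree_aeval_le _ (fun i => ?_) f
  fin_cases i <;> simp

/-- Two polynomials restricting to powers of distinct variables on a line, of degrees bounded by the
exponents, have no common factor. -/
theorem dvd_of_mul_eq_mul_of_restrictLine {a b : MvPolynomial (Fin 3) ℂ} {M N : ℕ}
    (ha : restrictLine a = X 1 ^ N) (hb : restrictLine b = X 0 ^ M) (hdeg : a.totalDegree ≤ N) :
    ∀ f g : MvPolynomial (Fin 3) ℂ, b * f = a * g → a ∣ f := by
  have hz : (X 2 : MvPolynomial (Fin 3) ℂ) ≠ 0 := X_ne_zero _
  suffices H : ∀ n, ∀ f g : MvPolynomial (Fin 3) ℂ, f.totalDegree ≤ n → b * f = a * g → a ∣ f from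
    fun f g => H _ f g le_rfl
  intro n
  induction n using Nat.strong_induction_on with
  | _ n ih =>
    intro f g hf hfg
    have h1 : X 0 ^ M * restrictLine f = X 1 ^ N * restrictLine g := by
      rw [← hb, ← ha, ← map_mul, hfg, map_mul]
    have h2 : (X 1 ^ N : MvPolynomial (Fin 3) ℂ) ∣ restrictLine f := by
      refine Prime.pow_dvd_of_dvd_mul_left X_prime N (a := X 0 ^ M) ?_ ⟨_, h1⟩
      intro h
      have := (X_prime (i := (1 : Fin 3)) (R := ℂ)).dvd_of_dvd_pow h
      simp [X_dvd_X] at this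
    obtain ⟨h, hh⟩ := h2
    obtain ⟨f0, hf0⟩ : (X 2 : MvPolynomial (Fin 3) ℂ) ∣ f - a * h := by
      obtain ⟨u, hu⟩ := X_two_dvd_sub_restrictLine f
      obtain ⟨v, hv⟩ := X_two_dvd_sub_restrictLine a
      exact ⟨u - v * h, by rw [mul_sub, ← mul_assoc, ← hu, ← hv, hh, ha]; ring⟩
    obtain ⟨g0, hg0⟩ : (X 2 : MvPolynomial (Fin 3) ℂ) ∣ g - b * h := by
      obtain ⟨u, hu⟩ := X_two_dvd_sub_restrictLine g
      obtain ⟨v, hv⟩ := X_two_dvd_sub_restrictLine b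
      have : restrictLine g = X 0 ^ M * h := by
        apply mul_left_cancel₀ (pow_ne_zero N (X_ne_zero (R := ℂ) (1 : Fin 3)))
        rw [← h1, hh]; ring
      exact ⟨u - v * h, by rw [mul_sub, ← mul_assoc, ← hu, ← hv, hb, this]; ring⟩
    by_cases hf00 : f0 = 0
    · rw [hf00, mul_zero, sub_eq_zero] at hf0
      exact ⟨h, hf0⟩
    have h3 : (X 2 * f0).totalDegree ≤ n := by
      rw [← hf0]
      refine (totalDegree_sub _ _).trans (max_le hf ?_)
      by_cases hh0 : h = 0
      · simp [hh0]
      refine (totalDegree_mul _ _).trans ?_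
      have := (totalDegree_restrictLine_le f).trans hf
      rw [hh, totalDegree_mul_of_isDomain (pow_ne_zero N (X_ne_zero _)) hh0, totalDegree_X_pow]
        at this
      omega
    rw [totalDegree_mul_of_isDomain hz hf00, totalDegree_X] at h3
    have h4 : a ∣ f0 := by
      refine ih (n - 1) (by omega) f0 g0 (by omega) ?_
      apply mul_left_cancel₀ hz
      have e1 : X 2 * (b * f0) = b * (X 2 * f0) := by ring
      have e2 : X 2 * (a * g0) = a * (X 2 * g0) := by ring
      rw [e1, e2, ← hf0, ← hg0, mul_sub, mul_sub, hfg]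
      ring
    rw [← sub_add_cancel f (a * h), hf0]
    exact dvd_add (h4.mul_left _) (dvd_mul_right _ _)

theorem isZeroDimIdeal_minorsIdeal {k : ℕ}
    (A : Matrix (Fin k) (Fin (k + 1)) (MvPolynomial (Fin 3) ℂ)) (p r : Fin k → ℕ)
    (hA : A.map restrictLine = bidiag (fun i => X 0 ^ p i) (fun i => X 1 ^ r i))
    (hpos : ∃ i, 0 < p i ∧ 0 < r i)
    (hdeg : (A.submatrix id (0 : Fin (k + 1)).succAbove).det.totalDegree ≤ ∑ i, r i) :
    IsZeroDimIdeal (minorsIdeal A) := by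
  set J : Fin (k + 1) → MvPolynomial (Fin 3) ℂ := fun c => (A.submatrix id c.succAbove).det
    with hJ
  have hJr : ∀ c, restrictLine (J c) = mixedProd (fun i => X 0 ^ p i) (fun i => X 1 ^ r i) c := by
    intro c
    rw [← det_bidiag_submatrix, ← hA, hJ]
    simp only
    rw [AlgHom.map_det]
    rfl
  have hJ0 : restrictLine (J 0) = X 1 ^ ∑ i, r i := by
    rw [hJr, mixedProd_zero, Finset.prod_pow_eq_pow_sum]
  have hJk : restrictLine (J (Fin.last k)) = X 0 ^ ∑ i, p i := by
    rw [hJr, mixedProd_last, Finset.prod_pow_eq_pow_sum]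
  have hmem : ∀ c, J c ∈ minorsIdeal A := fun c => Ideal.subset_span ⟨c, rfl⟩
  have hJ0ne : J 0 ≠ 0 := by
    intro h
    rw [h, map_zero] at hJ0
    exact pow_ne_zero _ (X_ne_zero _) hJ0.symm
  have hz : (X 2 : MvPolynomial (Fin 3) ℂ) ≠ 0 := X_ne_zero _
  have upper : ringKrullDim (MvPolynomial (Fin 3) ℂ ⧸ minorsIdeal A) ≤ 1 := by
    have h3 : ringKrullDim (MvPolynomial (Fin 3) ℂ) = 3 := by
      rw [MvPolynomial.ringKrullDim_of_isNoetherianRing, ringKrullDim_eq_zero_of_field]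
      simp
    have s1 : ringKrullDim (MvPolynomial (Fin 3) ℂ ⧸ Ideal.span {J 0}) + 1 ≤ 3 := by
      rw [← h3]
      exact ringKrullDim_quotient_succ_le_of_nonZeroDivisor (mem_nonZeroDivisors_of_ne_zero hJ0ne)
    have hle : Ideal.span {J 0} ≤ minorsIdeal A := by
      rw [Ideal.span_singleton_le_iff_mem]; exact hmem 0
    have s2 : ringKrullDim (MvPolynomial (Fin 3) ℂ ⧸ minorsIdeal A) + 1 ≤
        ringKrullDim (MvPolynomial (Fin 3) ℂ ⧸ Ideal.span {J 0}) := by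
      refine ringKrullDim_succ_le_of_surjective (Ideal.Quotient.factor hle)
        (Ideal.Quotient.factor_surjective hle)
        (r := Ideal.Quotient.mk _ (J (Fin.last k))) ?_ ?_
      · rw [mem_nonZeroDivisors_iff_right]
        intro x hx
        obtain ⟨f, rfl⟩ := Ideal.Quotient.mk_surjective x
        rw [← map_mul, Ideal.Quotient.eq_zero_iff_mem, Ideal.mem_span_singleton] at hx
        obtain ⟨g, hg⟩ := hx
        rw [Ideal.Quotient.eq_zero_iff_mem, Ideal.mem_span_singleton]
        exact dvd_of_mul_eq_mul_of_restrictLine hJ0 hJk hdeg f g (by rw [mul_comm, hg])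
      · rw [Ideal.Quotient.factor_mk, Ideal.Quotient.eq_zero_iff_mem]
        exact hmem _
    have s3 : ringKrullDim (MvPolynomial (Fin 3) ℂ ⧸ minorsIdeal A) + 1 + 1 ≤ 1 + 1 + 1 := by
      refine (add_le_add_left s2 1).trans (s1.trans ?_)
      norm_num
    exact (ENat.WithBot.add_le_add_one_right_iff.mp (ENat.WithBot.add_le_add_one_right_iff.mp s3))
  have hconst : ∀ f ∈ minorsIdeal A, constantCoeff f = 0 := by
    intro f hf
    have : minorsIdeal A ≤ RingHom.ker (constantCoeff (R := ℂ) (σ := Fin 3)) := by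
      refine Ideal.span_le.mpr ?_
      rintro _ ⟨c, rfl⟩
      change constantCoeff (J c) = 0
      rw [← constantCoeff_restrictLine, hJr, mixedProd, map_prod]
      obtain ⟨i, hp, hr⟩ := hpos
      refine Finset.prod_eq_zero (Finset.mem_univ i) ?_
      split_ifs <;> simp <;> omega
    exact this hf
  have hnzd : ∀ f, f * X 2 ∈ minorsIdeal A → f ∈ minorsIdeal A := by
    intro f hf
    obtain ⟨α, hα⟩ := (Ideal.mem_span_range_iff_exists_fun).mp hf
    have hsq : ∀ c : Fin (k + 1), ((-1) ^ (c : ℕ) * (-1) ^ (c : ℕ) : MvPolynomial (Fin 3) ℂ) = 1 :=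
      fun c => by rw [← mul_pow]; simp
    set a : Fin (k + 1) → MvPolynomial (Fin 3) ℂ := fun c => (-1) ^ (c : ℕ) * α c with ha
    have ha1 : ∑ c : Fin (k + 1), (-1) ^ (c : ℕ) * a c * J c = f * X 2 := by
      rw [← hα]
      refine Finset.sum_congr rfl fun c _ => ?_
      rw [ha]
      simp only
      rw [← mul_assoc, hsq, one_mul]
    obtain ⟨γ, hγ⟩ := exists_vecMul_bidiag_of_sum_eq_zero
      (fun i => (X 0 ^ p i : MvPolynomial (Fin 3) ℂ)) (fun i => X 1 ^ r i)
      (fun i => pow_ne_zero _ (X_ne_zero _)) (fun i j t ht => by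
        refine Prime.pow_dvd_of_dvd_mul_left X_prime _ (fun h => ?_) ht
        have := (X_prime (i := (0 : Fin 3)) (R := ℂ)).dvd_of_dvd_pow h
        simp [X_dvd_X] at this) (fun c => restrictLine (a c)) (by
        have := congrArg restrictLine ha1
        simpa [hJr] using this)
    have hβ : ∀ c, (X 2 : MvPolynomial (Fin 3) ℂ) ∣ a c - (γ ᵥ* A) c := by
      intro c
      have e : a c - (γ ᵥ* A) c = (a c - restrictLine (a c)) -
          ∑ i, γ i * (A i c - restrictLine (A i c)) := by
        have h1 : restrictLine (a c) = (γ ᵥ* A.map restrictLine) c := hA ▸ congrFun hγ c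
        rw [h1]
        simp only [Matrix.vecMul, dotProduct, mul_sub, Finset.sum_sub_distrib, Matrix.map_apply]
        ring
      rw [e]
      exact dvd_sub (X_two_dvd_sub_restrictLine _)
        (Finset.dvd_sum fun i _ => (X_two_dvd_sub_restrictLine _).mul_left _)
    choose β hβ using hβ
    have : f = ∑ c : Fin (k + 1), (-1) ^ (c : ℕ) * β c * J c := by
      apply mul_right_cancel₀ hz
      rw [← ha1, ← sub_zero (∑ c : Fin (k + 1), _), ← sum_vecMul_mul_minor A γ,
        ← Finset.sum_sub_distrib, Finset.sum_mul]
      refine Finset.sum_congr rfl fun c _ => ?_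
      have := hβ c
      linear_combination (-1) ^ (c : ℕ) * J c * this
    rw [this]
    exact Ideal.sum_mem _ fun c _ => Ideal.mul_mem_left _ _ (hmem c)
  refine le_antisymm upper ?_
  have h0 := ringKrullDim_succ_le_of_surjective
    (Ideal.Quotient.lift (minorsIdeal A) (constantCoeff (R := ℂ) (σ := Fin 3)) hconst)
    (Ideal.Quotient.lift_surjective_of_surjective _ _ fun c => ⟨C c, constantCoeff_C _ c⟩)
    (r := Ideal.Quotient.mk _ (X 2)) (by
      rw [mem_nonZeroDivisors_iff_right]
      intro x hx
      obtain ⟨f, rfl⟩ := Ideal.Quotient.mk_surjective x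
      rw [← map_mul, Ideal.Quotient.eq_zero_iff_mem] at hx
      rw [Ideal.Quotient.eq_zero_iff_mem]
      exact hnzd f hx) (by simp)
  rw [ringKrullDim_eq_zero_of_field, zero_add] at h0
  exact h0

end Dimension

section PointIdeals

/-- The parametrised line through the origin and `(a, b, 1)`. -/
noncomputable def evalLine (a b : ℂ) : MvPolynomial (Fin 3) ℂ →ₐ[ℂ] Polynomial ℂ :=
  aeval ![Polynomial.C a * Polynomial.X, Polynomial.C b * Polynomial.X, Polynomial.X]

/-- The linear form `X i - a X 2`. -/
noncomputable def linForm (i : Fin 3) (a : ℂ) : MvPolynomial (Fin 3) ℂ := X i - C a * X 2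

theorem linForm_isHomogeneous (i : Fin 3) (a : ℂ) : (linForm i a).IsHomogeneous 1 := by
  refine (isHomogeneous_X _ _).sub ?_
  simpa using (isHomogeneous_C (Fin 3) a).mul (isHomogeneous_X ℂ (2 : Fin 3))

theorem evalLine_linForm_zero (a b c : ℂ) :
    evalLine a b (linForm 0 c) = Polynomial.C (a - c) * Polynomial.X := by
  simp [evalLine, linForm, sub_mul, Polynomial.algebraMap_eq]

theorem evalLine_linForm_one (a b c : ℂ) :
    evalLine a b (linForm 1 c) = Polynomial.C (b - c) * Polynomial.X := by
  simp [evalLine, linForm, sub_mul, Polynomial.algebraMap_eq]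

theorem mem_span_pair_of_evalLine_eq_zero {a b : ℂ} {f : MvPolynomial (Fin 3) ℂ}
    (h : evalLine a b f = 0) : f ∈ Ideal.span {linForm 0 a, linForm 1 b} := by
  set I : Ideal (MvPolynomial (Fin 3) ℂ) := Ideal.span {linForm 0 a, linForm 1 b}
  have key : Ideal.Quotient.mkₐ ℂ I =
      ((Ideal.Quotient.mkₐ ℂ I).comp (Polynomial.aeval (X 2))).comp (evalLine a b) := by
    ext i
    have h0 : linForm 0 a ∈ I := Ideal.subset_span (by simp)
    have h1 : linForm 1 b ∈ I := Ideal.subset_span (by simp)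
    rw [AlgHom.comp_apply, AlgHom.comp_apply]
    simp only [Ideal.Quotient.mkₐ_eq_mk, evalLine, aeval_X]
    rw [Ideal.Quotient.mk_eq_mk_iff_sub_mem]
    fin_cases i
    · simpa [linForm, MvPolynomial.algebraMap_eq] using h0
    · simpa [linForm, MvPolynomial.algebraMap_eq] using h1
    · simp
  have := DFunLike.congr_fun key f
  rw [AlgHom.comp_apply, h, map_zero] at this
  exact Ideal.Quotient.eq_zero_iff_mem.mp this

theorem evalLine_of_isHomogeneous {a b : ℂ} {f : MvPolynomial (Fin 3) ℂ} {d : ℕ}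
    (hf : f.IsHomogeneous d) :
    evalLine a b f = Polynomial.C (eval ![a, b, 1] f) * Polynomial.X ^ d := by
  rw [evalLine, aeval_def, eval₂_eq', eval_eq', map_sum, Finset.sum_mul]
  refine Finset.sum_congr rfl fun m hm => ?_
  have hd := hf (mem_support_iff.mp hm)
  rw [Finsupp.weight_apply, Finsupp.sum_fintype _ _ (by simp)] at hd
  simp only [Fin.sum_univ_three, Pi.one_apply, smul_eq_mul, mul_one] at hd
  simp only [Fin.prod_univ_three, Polynomial.algebraMap_eq, map_mul, map_pow, Matrix.cons_val_zero,
    Matrix.cons_val_one, Matrix.cons_val, mul_pow, one_pow, map_one]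
  rw [← hd]
  ring

theorem exists_of_forall_evalLine_eq_zero {a : ℂ} (s : Finset ℂ) {f : MvPolynomial (Fin 3) ℂ}
    (h : ∀ b ∈ s, evalLine a b f = 0) :
    ∃ u v, f = u * linForm 0 a + v * ∏ b ∈ s, linForm 1 b := by
  induction s using Finset.induction_on with
  | empty => exact ⟨0, f, by simp⟩
  | insert b s hb ih =>
    obtain ⟨u, v, rfl⟩ := ih fun b' hb' => h b' (Finset.mem_insert_of_mem hb')
    have h1 := h b (Finset.mem_insert_self _ _)
    rw [map_add, map_mul, map_mul, evalLine_linForm_zero, sub_self, map_zero, zero_mul, mul_zero,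
      zero_add, map_prod, mul_eq_zero, Finset.prod_eq_zero_iff] at h1
    have h2 : evalLine a b v = 0 := by
      refine h1.resolve_right ?_
      rintro ⟨b', hb', h3⟩
      rw [evalLine_linForm_one, mul_eq_zero, Polynomial.C_eq_zero, sub_eq_zero] at h3
      rcases h3 with rfl | h3
      · exact hb hb'
      · exact Polynomial.X_ne_zero h3
    obtain ⟨u', v', rfl⟩ := Ideal.mem_span_pair.mp (mem_span_pair_of_evalLine_eq_zero h2)
    refine ⟨u + u' * ∏ b ∈ s, linForm 1 b, v', ?_⟩
    rw [Finset.prod_insert hb]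
    ring

theorem exists_of_forall_evalLine_eq_zero_grid (s t : Finset ℂ) {f : MvPolynomial (Fin 3) ℂ}
    (h : ∀ a ∈ s, ∀ b ∈ t, evalLine a b f = 0) :
    ∃ u v, f = u * ∏ a ∈ s, linForm 0 a + v * ∏ b ∈ t, linForm 1 b := by
  induction s using Finset.induction_on with
  | empty => exact ⟨f, 0, by simp⟩
  | insert a s ha ih =>
    obtain ⟨u, v, rfl⟩ := ih fun a' ha' => h a' (Finset.mem_insert_of_mem ha')
    have h2 : ∀ b ∈ t, evalLine a b u = 0 := by
      intro b hb
      have h1 := h a (Finset.mem_insert_self _ _) b hb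
      rw [map_add, map_mul, map_mul, map_prod, map_prod, Finset.prod_eq_zero (i := b) (s := t) hb
        (by rw [evalLine_linForm_one, sub_self, map_zero, zero_mul]), mul_zero, add_zero,
        mul_eq_zero, Finset.prod_eq_zero_iff] at h1
      refine h1.resolve_right ?_
      rintro ⟨a', ha', h3⟩
      rw [evalLine_linForm_zero, mul_eq_zero, Polynomial.C_eq_zero, sub_eq_zero] at h3
      rcases h3 with rfl | h3
      · exact ha ha'
      · exact Polynomial.X_ne_zero h3
    obtain ⟨u', v', rfl⟩ := exists_of_forall_evalLine_eq_zero t h2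
    refine ⟨u', v + v' * ∏ a ∈ s, linForm 0 a, ?_⟩
    rw [Finset.prod_insert ha]
    ring

/-- Polynomials vanishing on a staircase of grids are combinations of the mixed products. -/
theorem exists_eq_sum_mixedProd {k : ℕ} (s t : Fin k → Finset ℂ)
    (hs : ∀ i j, i ≠ j → Disjoint (s i) (s j)) (ht : ∀ i j, i ≠ j → Disjoint (t i) (t j))
    (f : MvPolynomial (Fin 3) ℂ)
    (h : ∀ i j, i ≤ j → ∀ a ∈ s i, ∀ b ∈ t j, evalLine a b f = 0) :
    ∃ g : Fin (k + 1) → MvPolynomial (Fin 3) ℂ, f = ∑ c, g c *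
      mixedProd (fun i => ∏ a ∈ s i, linForm 0 a) (fun j => ∏ b ∈ t j, linForm 1 b) c := by
  induction k generalizing f with
  | zero => exact ⟨fun _ => f, by simp [mixedProd]⟩
  | succ k ih =>
    obtain ⟨u, v, rfl⟩ := exists_of_forall_evalLine_eq_zero_grid (s 0) (Finset.univ.biUnion t)
      (f := f) (fun a ha b hb => by
        obtain ⟨j, _, hj⟩ := Finset.mem_biUnion.mp hb
        exact h 0 j (Fin.zero_le _) a ha b hj)
    rw [Finset.prod_biUnion (fun i _ j _ hij => ht i j hij)] at h ⊢
    obtain ⟨g, hg⟩ := ih (fun i => s i.succ) (fun i => t i.succ)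
      (fun i j hij => hs _ _ (by simpa using hij)) (fun i j hij => ht _ _ (by simpa using hij)) u
      (by
        intro i j hij a ha b hb
        have h1 := h i.succ j.succ (Fin.succ_le_succ_iff.mpr hij) a ha b hb
        rw [map_add, map_mul, map_mul, map_prod, map_prod,
          Finset.prod_eq_zero (Finset.mem_univ j.succ), mul_zero, add_zero, mul_eq_zero,
          Finset.prod_eq_zero_iff] at h1
        · refine h1.resolve_right ?_
          rintro ⟨a', ha', h3⟩
          rw [evalLine_linForm_zero, mul_eq_zero, Polynomial.C_eq_zero, sub_eq_zero] at h3
          rcases h3 with rfl | h3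
          · exact Finset.disjoint_left.mp (hs 0 i.succ (Fin.succ_ne_zero _).symm) ha' ha
          · exact Polynomial.X_ne_zero h3
        · rw [map_prod]
          refine Finset.prod_eq_zero hb ?_
          rw [evalLine_linForm_one, sub_self, map_zero, zero_mul])
    refine ⟨Fin.cons v g, ?_⟩
    rw [Fin.sum_univ_succ, mixedProd_zero]
    simp only [mixedProd_succ, Fin.cons_zero, Fin.cons_succ]
    rw [add_comm, hg, Finset.sum_mul]
    congr 1
    exact Finset.sum_congr rfl fun i _ => by ring

/-- Newton interpolation on a triangle. -/
theorem exists_form_eval_eq (a b : ℕ → ℂ) (M N : ℕ) (ha : Set.InjOn a (Set.Iio M))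
    (hb : Set.InjOn b (Set.Iio N)) (φ : ℕ → ℕ → ℂ) (D : ℕ) :
    ∃ f : MvPolynomial (Fin 3) ℂ, IsFormOfDeg f ((D : ℤ) - 1) ∧
      ∀ m < M, ∀ n < N, m + n < D → eval ![a m, b n, 1] f = φ m n := by
  induction D with
  | zero => exact ⟨0, by simp [IsFormOfDeg], fun m _ n _ h => absurd h (by omega)⟩
  | succ D ih =>
    obtain ⟨f, hf, hfe⟩ := ih
    set T : ℕ → MvPolynomial (Fin 3) ℂ := fun m =>
      (∏ i ∈ Finset.range m, linForm 0 (a i)) * ∏ i ∈ Finset.range (D - m), linForm 1 (b i) with hT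
    have hTe : ∀ m x y, eval ![x, y, 1] (T m) =
        (∏ i ∈ Finset.range m, (x - a i)) * ∏ i ∈ Finset.range (D - m), (y - b i) := by
      intro m x y
      simp [hT, linForm, map_prod]
    set c : ℕ → ℂ := fun m => (φ m (D - m) - eval ![a m, b (D - m), 1] f) /
      eval ![a m, b (D - m), 1] (T m) with hc
    refine ⟨X 2 * f + ∑ m ∈ Finset.range (D + 1), C (c m) * T m, ?_, ?_⟩
    · have e : (((D + 1 : ℕ) : ℤ) - 1) = (D : ℕ) := by simp
      rw [e, isFormOfDeg_natCast]
      refine IsHomogeneous.add ?_ (IsHomogeneous.sum _ _ _ fun m hm => ?_)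
      · rcases Nat.eq_zero_or_pos D with rfl | hD
        · simp only [IsFormOfDeg] at hf
          rw [if_pos (by simp)] at hf
          rw [hf, mul_zero]
          exact isHomogeneous_zero _ _ _
        · have e : ((D : ℤ) - 1) = ((D - 1 : ℕ) : ℤ) := by omega
          rw [e, isFormOfDeg_natCast] at hf
          have := (isHomogeneous_X ℂ (2 : Fin 3)).mul hf
          rwa [show 1 + (D - 1) = D by omega] at this
      · have h1 : (T m).IsHomogeneous (m + (D - m)) := by
          refine IsHomogeneous.mul ?_ ?_
          · simpa using IsHomogeneous.prod (Finset.range m) (fun i => linForm 0 (a i)) (fun _ => 1)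
              fun i _ => linForm_isHomogeneous _ _
          · simpa using IsHomogeneous.prod (Finset.range (D - m)) (fun i => linForm 1 (b i))
              (fun _ => 1) fun i _ => linForm_isHomogeneous _ _
        have := Finset.mem_range.mp hm
        rw [show m + (D - m) = D by omega] at h1
        exact h1.C_mul _
    · intro m hm n hn hmn
      have hzero : ∀ m' ∈ Finset.range (D + 1), m' ≠ m ∨ m + n < D →
          eval ![a m, b n, 1] (C (c m') * T m') = 0 := by
        intro m' hm' h
        have := Finset.mem_range.mp hm'
        rw [map_mul, hTe]
        by_cases h1 : m < m'
        · rw [Finset.prod_eq_zero (Finset.mem_range.mpr h1) (sub_self _)]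
          ring
        · rw [Finset.prod_eq_zero (s := Finset.range (D - m'))
            (Finset.mem_range.mpr (show n < D - m' by omega)) (sub_self _)]
          ring
      rw [map_add, map_mul, map_sum, eval_X]
      simp only [Matrix.cons_val, one_mul]
      rcases Nat.lt_or_ge (m + n) D with h | h
      · rw [Finset.sum_eq_zero fun m' hm' => hzero m' hm' (Or.inr h), add_zero]
        exact hfe m hm n hn h
      · obtain rfl : n = D - m := by omega
        rw [Finset.sum_eq_single m (fun m' hm' h' => hzero m' hm' (Or.inl h'))
          (fun h' => absurd (Finset.mem_range.mpr (by omega)) h'), map_mul, eval_C, hc]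
        simp only
        rw [div_mul_cancel₀, add_sub_cancel]
        rw [hTe, mul_ne_zero_iff, Finset.prod_ne_zero_iff, Finset.prod_ne_zero_iff]
        constructor
        · intro i hi
          have hi := Finset.mem_range.mp hi
          rw [sub_ne_zero]
          intro h
          have := ha (Set.mem_Iio.mpr hm) (Set.mem_Iio.mpr (by omega)) h
          omega
        · intro i hi
          have hi := Finset.mem_range.mp hi
          rw [sub_ne_zero]
          intro h
          have := hb (Set.mem_Iio.mpr hn) (Set.mem_Iio.mpr (by omega)) h
          omega

end PointIdeals

section Forms

variable {k : ℕ}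

theorem IsFormOfDeg.zero (m : ℤ) : IsFormOfDeg (0 : MvPolynomial (Fin k) ℂ) m := by
  rw [IsFormOfDeg]
  split_ifs
  · rfl
  · exact isHomogeneous_zero _ _ _

theorem IsFormOfDeg.add {f g : MvPolynomial (Fin k) ℂ} {m : ℤ} (hf : IsFormOfDeg f m)
    (hg : IsFormOfDeg g m) : IsFormOfDeg (f + g) m := by
  rw [IsFormOfDeg] at *
  split_ifs at *
  · simp [hf, hg]
  · exact IsHomogeneous.add hf hg

theorem IsFormOfDeg.mul {f g : MvPolynomial (Fin k) ℂ} {m n : ℤ} (hf : IsFormOfDeg f m)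
    (hg : IsFormOfDeg g n) : IsFormOfDeg (f * g) (m + n) := by
  rcases lt_or_ge m 0 with hm | hm
  · rw [IsFormOfDeg, if_pos hm] at hf
    rw [hf, zero_mul]
    exact IsFormOfDeg.zero _
  rcases lt_or_ge n 0 with hn | hn
  · rw [IsFormOfDeg, if_pos hn] at hg
    rw [hg, mul_zero]
    exact IsFormOfDeg.zero _
  lift m to ℕ using hm
  lift n to ℕ using hn
  rw [isFormOfDeg_natCast] at hf hg
  rw [← Nat.cast_add, isFormOfDeg_natCast]
  exact hf.mul hg

theorem isFormOfDeg_C (c : ℂ) : IsFormOfDeg (C c : MvPolynomial (Fin k) ℂ) 0 := by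
  rw [← Nat.cast_zero, isFormOfDeg_natCast]
  exact isHomogeneous_C _ _

theorem IsFormOfDeg.sum {ι : Type*} (s : Finset ι) (f : ι → MvPolynomial (Fin k) ℂ) {m : ℤ}
    (h : ∀ i ∈ s, IsFormOfDeg (f i) m) : IsFormOfDeg (∑ i ∈ s, f i) m :=
  Finset.sum_induction _ (IsFormOfDeg · m) (fun _ _ => IsFormOfDeg.add) (IsFormOfDeg.zero m) h

theorem IsFormOfDeg.prod {ι : Type*} (s : Finset ι) (f : ι → MvPolynomial (Fin k) ℂ) (m : ι → ℤ)
    (h : ∀ i ∈ s, IsFormOfDeg (f i) (m i)) : IsFormOfDeg (∏ i ∈ s, f i) (∑ i ∈ s, m i) := by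
  classical
  induction s using Finset.induction_on with
  | empty => simpa using isFormOfDeg_C (k := k) 1
  | insert i s hi ih =>
    rw [Finset.prod_insert hi, Finset.sum_insert hi]
    exact (h i (Finset.mem_insert_self _ _)).mul
      (ih fun j hj => h j (Finset.mem_insert_of_mem hj))

theorem IsFormOfDeg.det {n : ℕ} {A : Matrix (Fin n) (Fin n) (MvPolynomial (Fin k) ℂ)}
    {a b : Fin n → ℤ} (h : ∀ i j, IsFormOfDeg (A i j) (b i - a j)) :
    IsFormOfDeg A.det (∑ i, b i - ∑ j, a j) := by
  rw [Matrix.det_apply']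
  refine IsFormOfDeg.sum _ _ fun σ _ => ?_
  have h1 : IsFormOfDeg ((Equiv.Perm.sign σ : ℤ) : MvPolynomial (Fin k) ℂ) 0 := by
    rw [← map_intCast (C (R := ℂ) (σ := Fin k))]
    exact isFormOfDeg_C _
  have h2 := IsFormOfDeg.prod Finset.univ (fun i => A (σ i) i) (fun i => b (σ i) - a i)
    fun i _ => h _ _
  rw [Finset.sum_sub_distrib, Equiv.sum_comp σ b] at h2
  simpa using h1.mul h2

/-- The space of forms of degree `m`. -/
def formSubmodule (k : ℕ) (m : ℤ) : Submodule ℂ (MvPolynomial (Fin k) ℂ) where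
  carrier := {f | IsFormOfDeg f m}
  add_mem' := IsFormOfDeg.add
  zero_mem' := IsFormOfDeg.zero m
  smul_mem' c f hf := by
    change IsFormOfDeg (c • f) m
    rw [smul_eq_C_mul]
    simpa using (isFormOfDeg_C c).mul hf

theorem mem_formSubmodule {m : ℤ} {f : MvPolynomial (Fin k) ℂ} :
    f ∈ formSubmodule k m ↔ IsFormOfDeg f m := Iff.rfl

instance (m : ℤ) : FiniteDimensional ℂ (formSubmodule k m) := by
  have : formSubmodule k m ≤ restrictTotalDegree (Fin k) ℂ m.toNat := by
    intro f hf
    rw [mem_formSubmodule, IsFormOfDeg] at hf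
    rw [mem_restrictTotalDegree]
    split_ifs at hf
    · simp [hf]
    · exact hf.totalDegree_le
  exact Submodule.finiteDimensional_of_le this

instance {ι : Type*} [Finite ι] (m : ι → ℤ) :
    FiniteDimensional ℂ (Submodule.pi Set.univ fun i => formSubmodule k (m i)) := by
  let φ : (Submodule.pi Set.univ fun i => formSubmodule k (m i)) →ₗ[ℂ]
      ∀ i, formSubmodule k (m i) :=
    LinearMap.pi fun i => LinearMap.codRestrict _ ((LinearMap.proj i).comp (Submodule.subtype _))
      fun u => u.2 i (Set.mem_univ _)
  refine FiniteDimensional.of_injective φ fun u v h => ?_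
  ext1
  funext i
  exact congrArg Subtype.val (congrFun h i)

/-- A form in the ideal generated by forms is a combination of them with forms as coefficients. -/
theorem exists_form_coeff {ι : Type*} [Fintype ι] (J : ι → MvPolynomial (Fin k) ℂ) (e : ι → ℕ)
    (hJ : ∀ c, (J c).IsHomogeneous (e c)) {d : ℕ} {f : MvPolynomial (Fin k) ℂ}
    (hf : f.IsHomogeneous d) (g : ι → MvPolynomial (Fin k) ℂ) (hg : f = ∑ c, g c * J c) :
    ∃ g' : ι → MvPolynomial (Fin k) ℂ, (∀ c, IsFormOfDeg (g' c) ((d : ℤ) - e c)) ∧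
      f = ∑ c, g' c * J c := by
  refine ⟨fun c => if e c ≤ d then homogeneousComponent (d - e c) (g c) else 0, fun c => ?_, ?_⟩
  · dsimp only
    split_ifs with h
    · rw [← Nat.cast_sub h, isFormOfDeg_natCast]
      exact homogeneousComponent_isHomogeneous _ _
    · exact IsFormOfDeg.zero _
  · have h1 : homogeneousComponent d f = f := by
      rw [homogeneousComponent_of_mem hf, if_pos rfl]
    rw [← h1, hg, map_sum]
    refine Finset.sum_congr rfl fun c _ => ?_
    conv_lhs => rw [← sum_homogeneousComponent (g c), Finset.sum_mul, map_sum]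
    have h2 : ∀ i, homogeneousComponent d (homogeneousComponent i (g c) * J c) =
        if d = i + e c then homogeneousComponent i (g c) * J c else 0 := fun i =>
      homogeneousComponent_of_mem ((homogeneousComponent_isHomogeneous i (g c)).mul (hJ c))
    simp_rw [h2]
    split_ifs with h
    · rw [Finset.sum_eq_single (d - e c)]
      · rw [if_pos (by omega)]
      · intro i _ hi
        rw [if_neg (by omega)]
      · intro hi
        rw [Finset.mem_range, not_lt] at hi
        rw [if_pos (by omega), homogeneousComponent_eq_zero _ _ (by omega), zero_mul]
    · rw [zero_mul]
      exact Finset.sum_eq_zero fun i _ => if_neg (by omega)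

end Forms

theorem coeff_one_det {n R : Type*} [Fintype n] [DecidableEq n] [CommRing R]
    (P : Matrix n n (Polynomial R)) :
    P.det.coeff 1 =
      ∑ i, ∑ j, (P.map fun f => f.coeff 0).adjugate i j * (P j i).coeff 1 := by
  have hc1 : ∀ f : Polynomial R, f.coeff 1 = (Polynomial.derivative f).eval 0 := by
    intro f
    rw [← Polynomial.coeff_zero_eq_eval_zero, Polynomial.coeff_derivative]
    simp
  have hd : Polynomial.derivative P.det =
      ∑ i, (P.updateCol i fun j => Polynomial.derivative (P j i)).det := by
    simp_rw [Matrix.det_apply']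
    rw [map_sum, Finset.sum_comm]
    refine Finset.sum_congr rfl fun σ _ => ?_
    rw [Polynomial.derivative_intCast_mul, Polynomial.derivative_prod_finset, Finset.mul_sum]
    refine Finset.sum_congr rfl fun i _ => ?_
    rw [← Finset.mul_prod_erase _ _ (Finset.mem_univ i), Matrix.updateCol_self,
      mul_comm (Polynomial.derivative _)]
    congr 2
    refine Finset.prod_congr rfl fun j hj => ?_
    rw [Matrix.updateCol_ne (Finset.ne_of_mem_erase hj)]
  rw [hc1, hd, Polynomial.eval_finsetSum]
  refine Finset.sum_congr rfl fun i _ => ?_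
  rw [← Polynomial.coe_evalRingHom, RingHom.map_det]
  have : (Polynomial.evalRingHom 0).mapMatrix
      (P.updateCol i fun j => Polynomial.derivative (P j i)) =
      (P.map fun f => f.coeff 0).updateCol i fun j => (P j i).coeff 1 := by
    ext a b
    by_cases h : b = i
    · subst h
      simp [hc1]
    · simp [Matrix.updateCol_ne h, Polynomial.coeff_zero_eq_eval_zero]
  rw [this, ← Matrix.cramer_apply, Matrix.cramer_eq_adjugate_mulVec]
  rfl

section Bordered

/-- The square matrix obtained from `A` by adding `g` as first row. -/
def bordered {R : Type*} {k : ℕ} (g : Fin (k + 1) → R) (A : Matrix (Fin k) (Fin (k + 1)) R) :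
    Matrix (Fin (k + 1)) (Fin (k + 1)) R :=
  Matrix.of (Fin.cons g A)

@[simp] theorem bordered_zero {R : Type*} {k : ℕ} (g : Fin (k + 1) → R)
    (A : Matrix (Fin k) (Fin (k + 1)) R) (c : Fin (k + 1)) : bordered g A 0 c = g c := rfl

@[simp] theorem bordered_succ {R : Type*} {k : ℕ} (g : Fin (k + 1) → R)
    (A : Matrix (Fin k) (Fin (k + 1)) R) (r : Fin k) (c : Fin (k + 1)) :
    bordered g A r.succ c = A r c := rfl

theorem det_bordered {R : Type*} [CommRing R] {k : ℕ} (g : Fin (k + 1) → R)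
    (A : Matrix (Fin k) (Fin (k + 1)) R) :
    (bordered g A).det =
      ∑ c : Fin (k + 1), (-1) ^ (c : ℕ) * g c * (A.submatrix id c.succAbove).det :=
  Matrix.det_succ_row_zero _

theorem adjugate_bordered_zero {R : Type*} [CommRing R] {k : ℕ} (g : Fin (k + 1) → R)
    (A : Matrix (Fin k) (Fin (k + 1)) R) (c : Fin (k + 1)) :
    (bordered g A).adjugate c 0 = (-1) ^ (c : ℕ) * (A.submatrix id c.succAbove).det := by
  have : (bordered g A).updateRow 0 (Pi.single c 1) = bordered (Pi.single c 1) A := by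
    ext r c'
    induction r using Fin.cases with
    | zero => simp
    | succ r => simp
  rw [Matrix.adjugate_apply, this, det_bordered, Finset.sum_eq_single c]
  · simp
  · intro c' _ h
    simp [h]
  · simp

theorem bidiag_mulVec {R : Type*} [CommRing R] {k : ℕ} (P Q : Fin k → R) (u : Fin (k + 1) → R)
    (r : Fin k) : ∑ c, bidiag P Q r c * u c = P r * u r.castSucc + Q r * u r.succ := by
  have : ∀ c, bidiag P Q r c * u c =
      (if c = r.castSucc then P r * u c else 0) + if c = r.succ then Q r * u c else 0 := by
    intro c
    simp only [bidiag, Matrix.of_apply]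
    by_cases h : c = r.castSucc
    · rw [if_pos h, if_pos h, if_neg (by rw [h]; exact (Fin.castSucc_lt_succ).ne), add_zero]
    · rw [if_neg h, if_neg h, zero_add, ite_mul, zero_mul]
  simp [this, Finset.sum_add_distrib]

theorem bidiag_vecMul {R : Type*} [CommRing R] {k : ℕ} (P Q : Fin k → R) (y : Fin k → R)
    {l : ℕ} (hl : l + 1 < k) : ∑ r, y r * bidiag P Q r ⟨l + 1, by omega⟩ =
      y ⟨l + 1, hl⟩ * P ⟨l + 1, hl⟩ + y ⟨l, by omega⟩ * Q ⟨l, by omega⟩ := by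
  have : ∀ r, y r * bidiag P Q r ⟨l + 1, by omega⟩ =
      (if r = ⟨l + 1, hl⟩ then y r * P r else 0) +
        if r = ⟨l, by omega⟩ then y r * Q r else 0 := by
    intro r
    simp only [bidiag, Matrix.of_apply, Fin.ext_iff, Fin.val_castSucc, Fin.val_succ]
    split_ifs <;> first | omega | simp
  simp [this, Finset.sum_add_distrib]

theorem eq_zero_of_left_bidiag {k : ℕ} {P Q y : Fin k → ℂ} {i j : Fin k} (hij : i ≤ j)
    (hP : ∀ l, P l = 0 ↔ l = i) (hQ : ∀ l, Q l = 0 ↔ l = j)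
    (h : ∀ (l : ℕ) (hl : l + 1 < k),
      y ⟨l + 1, hl⟩ * P ⟨l + 1, hl⟩ + y ⟨l, by omega⟩ * Q ⟨l, by omega⟩ = 0)
    (r : Fin k) (hr : y r ≠ 0) : i ≤ r ∧ r ≤ j := by
  constructor
  · by_contra! hlt
    refine hr ?_
    clear hr
    obtain ⟨n, hn⟩ : ∃ n, (r : ℕ) + n + 1 = i := ⟨i - r - 1, by have : (r : ℕ) < i := hlt; omega⟩
    have hij : (i : ℕ) ≤ j := hij
    induction n generalizing r with
    | zero =>
      have h1 := h r (by omega)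
      rw [(hP _).mpr (Fin.ext (by simpa using hn)), mul_zero, zero_add, mul_eq_zero] at h1
      exact h1.resolve_right fun h2 => by
        have := congrArg Fin.val ((hQ _).mp h2)
        simp only at this
        omega
    | succ n ih =>
      have h1 := h r (by omega)
      rw [ih ⟨r + 1, by omega⟩ (Fin.mk_lt_of_lt_val (by omega)) (by simp only; omega),
        zero_mul, zero_add, mul_eq_zero] at h1
      exact h1.resolve_right fun h2 => by
        have := congrArg Fin.val ((hQ _).mp h2)
        simp only at this
        omega
  · by_contra! hlt
    refine hr ?_
    clear hr
    obtain ⟨n, hn⟩ : ∃ n, (j : ℕ) + n + 1 = r := ⟨r - j - 1, by have : (j : ℕ) < r := hlt; omega⟩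
    have hij : (i : ℕ) ≤ j := hij
    have hrk := r.2
    have hr1 : r = ⟨j + n + 1, by omega⟩ := Fin.ext hn.symm
    rw [hr1]
    clear hr1
    induction n generalizing r with
    | zero =>
      have h1 := h j (by omega)
      rw [(hQ _).mpr (Fin.ext rfl), mul_zero, add_zero, mul_eq_zero] at h1
      exact h1.resolve_right fun h2 => by
        have := congrArg Fin.val ((hP _).mp h2)
        simp only at this
        omega
    | succ n ih =>
      have h1 := h (j + n + 1) (by omega)
      rw [ih ⟨j + n + 1, by omega⟩ (Fin.lt_def.mpr (by simp only; omega)) rfl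
        (by simp only; omega), zero_mul, add_zero, mul_eq_zero] at h1
      exact h1.resolve_right fun h2 => by
        have := congrArg Fin.val ((hP _).mp h2)
        simp only at this
        omega

theorem eq_zero_ascending {k : ℕ} {P Q : Fin k → ℂ} {u : Fin (k + 1) → ℂ} {c₀ c : Fin (k + 1)}
    (h0 : u c₀ = 0) (hc : c₀ ≤ c)
    (h : ∀ r : Fin k, c₀ ≤ r.castSucc → r.castSucc < c →
      P r * u r.castSucc + Q r * u r.succ = 0 ∧ Q r ≠ 0) : u c = 0 := by
  induction c using Fin.induction with
  | zero =>
    rwa [← Fin.le_zero_iff.mp hc]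
  | succ r ih =>
    rcases hc.eq_or_lt with rfl | hlt
    · exact h0
    have hle : c₀ ≤ r.castSucc := Fin.le_castSucc_iff.mpr hlt
    obtain ⟨h1, h2⟩ := h r hle Fin.castSucc_lt_succ
    rw [ih hle fun r' h3 h4 => h r' h3 (h4.trans Fin.castSucc_lt_succ), mul_zero, zero_add,
      mul_eq_zero] at h1
    exact h1.resolve_left h2

theorem eq_zero_descending {k : ℕ} {P Q : Fin k → ℂ} {u : Fin (k + 1) → ℂ} {c₁ c : Fin (k + 1)}
    (h0 : u c₁ = 0) (hc : c ≤ c₁)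
    (h : ∀ r : Fin k, c ≤ r.castSucc → r.castSucc < c₁ →
      P r * u r.castSucc + Q r * u r.succ = 0 ∧ P r ≠ 0) : u c = 0 := by
  induction c using Fin.reverseInduction with
  | last =>
    rwa [← Fin.last_le_iff.mp hc]
  | cast r ih =>
    rcases hc.eq_or_lt with rfl | hlt
    · exact h0
    have hle : r.succ ≤ c₁ := Fin.castSucc_lt_iff_succ_le.mp hlt
    obtain ⟨h1, h2⟩ := h r le_rfl hlt
    rw [ih hle fun r' h3 h4 => h r' (Fin.castSucc_lt_succ.le.trans h3) h4, mul_zero, add_zero,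
      mul_eq_zero] at h1
    exact h1.resolve_left h2

theorem adjugate_bordered_relations {k : ℕ} {P Q : Fin k → ℂ} {g : Fin (k + 1) → ℂ}
    (hdet : (bordered g (bidiag P Q)).det = 0)
    (hg : ∀ (l : ℕ) (hl : l + 1 < k), g ⟨l + 1, by omega⟩ = 0)
    {i j : Fin k} (hij : i ≤ j) (hP : ∀ l, P l = 0 ↔ l = i) (hQ : ∀ l, Q l = 0 ↔ l = j) :
    (∀ r c, (bordered g (bidiag P Q)).adjugate c r.succ ≠ 0 → i ≤ r ∧ r ≤ j) ∧
    (∀ s, ∑ c, g c * (bordered g (bidiag P Q)).adjugate c s = 0) ∧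
    ∀ r s, P r * (bordered g (bidiag P Q)).adjugate r.castSucc s +
      Q r * (bordered g (bidiag P Q)).adjugate r.succ s = 0 := by
  have h1 := Matrix.adjugate_mul (bordered g (bidiag P Q))
  have h2 := Matrix.mul_adjugate (bordered g (bidiag P Q))
  rw [hdet, zero_smul] at h1 h2
  refine ⟨fun r c hr => ?_, fun s => ?_, fun r s => ?_⟩
  · refine eq_zero_of_left_bidiag (y := fun r => (bordered g (bidiag P Q)).adjugate c r.succ)
      hij hP hQ (fun l hl => ?_) r hr
    have h3 := congrFun (congrFun h1 c) ⟨l + 1, by omega⟩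
    rw [Matrix.mul_apply, Fin.sum_univ_succ] at h3
    simp only [bordered_zero, bordered_succ, hg l hl, mul_zero, zero_add] at h3
    rw [bidiag_vecMul P Q (fun r => (bordered g (bidiag P Q)).adjugate c r.succ) hl] at h3
    exact h3
  · have h3 := congrFun (congrFun h2 0) s
    rw [Matrix.mul_apply] at h3
    exact h3
  · have h3 := congrFun (congrFun h2 r.succ) s
    rw [Matrix.mul_apply] at h3
    simp only [bordered_succ] at h3
    rw [bidiag_mulVec P Q (fun c => (bordered g (bidiag P Q)).adjugate c s)] at h3
    exact h3

theorem adjugate_bordered_ne_zero {k : ℕ} {P Q : Fin k → ℂ} {g : Fin (k + 1) → ℂ}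
    (r₀ : Fin k) (c₀ : Fin (k + 1))
    (h : ∀ u : Fin (k + 1) → ℂ, u c₀ = 0 → ∑ c, g c * u c = 0 →
      (∀ r, r ≠ r₀ → P r * u r.castSucc + Q r * u r.succ = 0) → u = 0) :
    (bordered g (bidiag P Q)).adjugate c₀ r₀.succ ≠ 0 := by
  rw [Matrix.adjugate_apply]
  intro hdet
  obtain ⟨u, hu0, hu⟩ := Matrix.exists_mulVec_eq_zero_iff.mpr hdet
  refine hu0 (h u ?_ ?_ fun r hr => ?_)
  · have := congrFun hu r₀.succ
    rw [Matrix.mulVec, dotProduct, Matrix.updateRow_self] at this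
    simpa [Pi.single_apply] using this
  · have := congrFun hu 0
    rw [Matrix.mulVec, dotProduct, Matrix.updateRow_ne (Fin.succ_ne_zero r₀).symm] at this
    exact this
  · have := congrFun hu r.succ
    rw [Matrix.mulVec, dotProduct, Matrix.updateRow_ne (by simpa using hr)] at this
    rw [← bidiag_mulVec P Q u]
    exact this

theorem adjugate_bordered_single_zero {k : ℕ} {P Q : Fin k → ℂ} {i j : Fin k} (hij : i ≤ j)
    (hP : ∀ l, P l = 0 ↔ l = i) (hQ : ∀ l, Q l = 0 ↔ l = j) :
    (∀ r c, (bordered (Pi.single 0 1) (bidiag P Q)).adjugate c r.succ ≠ 0 →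
      i ≤ r ∧ r ≤ j ∧ j.succ ≤ c) ∧
    (bordered (Pi.single 0 1) (bidiag P Q)).adjugate j.succ i.succ ≠ 0 := by
  have hdet : (bordered (Pi.single 0 1) (bidiag P Q)).det = 0 := by
    rw [det_bordered, Finset.sum_eq_single 0 (fun c _ hc => by simp [hc]) (by simp),
      det_bidiag_submatrix, mixedProd_zero, Finset.prod_eq_zero (Finset.mem_univ j) ((hQ j).mpr rfl),
      mul_zero]
  obtain ⟨h1, h2, h3⟩ := adjugate_bordered_relations hdet
    (fun l hl => by simp [Fin.ext_iff]) hij hP hQ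
  have hsum : ∀ u : Fin (k + 1) → ℂ, ∑ c, (Pi.single 0 1 : Fin (k + 1) → ℂ) c * u c = u 0 := by
    intro u
    rw [Finset.sum_eq_single 0 (fun c _ hc => by simp [hc]) (by simp)]
    simp
  refine ⟨fun r c hrc => ⟨(h1 r c hrc).1, (h1 r c hrc).2, ?_⟩, ?_⟩
  · by_contra! hlt
    refine hrc (eq_zero_ascending (u := fun c => Matrix.adjugate _ c r.succ) (c₀ := 0)
      ((hsum _).symm.trans (h2 _)) (Fin.zero_le _) fun r' _ h5 => ⟨h3 r' _, fun h6 => ?_⟩)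
    rw [(hQ _).mp h6] at h5
    exact absurd hlt (not_lt.mpr (Fin.castSucc_lt_iff_succ_le.mp h5))
  · refine adjugate_bordered_ne_zero _ _ fun u hu0 hu1 hu2 => ?_
    rw [hsum] at hu1
    funext c
    rcases le_or_gt c i.castSucc with hc | hc
    · refine eq_zero_ascending (P := P) (Q := Q) hu1 (Fin.zero_le _) fun r _ hr => ?_
      have hri : r < i := by simpa using hr.trans_le hc
      exact ⟨hu2 r hri.ne, fun h => (hri.trans_le hij).ne ((hQ r).mp h)⟩
    · rcases le_or_gt c j.succ with hcj | hcj
      · refine eq_zero_descending (P := P) (Q := Q) hu0 hcj fun r hr _ => ?_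
        have hri : i < r := by simpa using hc.trans_le hr
        exact ⟨hu2 r hri.ne', fun h => hri.ne' ((hP r).mp h)⟩
      · refine eq_zero_ascending (P := P) (Q := Q) hu0 hcj.le fun r hr _ => ?_
        have hrj : j < r := by simpa using (Fin.castSucc_lt_succ (i := j)).trans_le hr
        exact ⟨hu2 r (hij.trans_lt hrj).ne', fun h => hrj.ne' ((hQ r).mp h)⟩

theorem adjugate_bordered_single_last {k : ℕ} {P Q : Fin k → ℂ} {i j : Fin k} (hij : i ≤ j)
    (hP : ∀ l, P l = 0 ↔ l = i) (hQ : ∀ l, Q l = 0 ↔ l = j) :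
    (∀ r c, (bordered (Pi.single (Fin.last k) 1) (bidiag P Q)).adjugate c r.succ ≠ 0 →
      i ≤ r ∧ r ≤ j ∧ c ≤ i.castSucc) ∧
    (bordered (Pi.single (Fin.last k) 1) (bidiag P Q)).adjugate i.castSucc j.succ ≠ 0 := by
  have hdet : (bordered (Pi.single (Fin.last k) 1) (bidiag P Q)).det = 0 := by
    rw [det_bordered, Finset.sum_eq_single (Fin.last k) (fun c _ hc => by simp [hc]) (by simp),
      det_bidiag_submatrix, mixedProd_last, Finset.prod_eq_zero (Finset.mem_univ i) ((hP i).mpr rfl),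
      mul_zero]
  obtain ⟨h1, h2, h3⟩ := adjugate_bordered_relations hdet
    (fun l hl => by rw [Pi.single_apply, if_neg]; simp [Fin.ext_iff]; omega) hij hP hQ
  have hsum : ∀ u : Fin (k + 1) → ℂ,
      ∑ c, (Pi.single (Fin.last k) 1 : Fin (k + 1) → ℂ) c * u c = u (Fin.last k) := by
    intro u
    rw [Finset.sum_eq_single (Fin.last k) (fun c _ hc => by simp [hc]) (by simp)]
    simp
  refine ⟨fun r c hrc => ⟨(h1 r c hrc).1, (h1 r c hrc).2, ?_⟩, ?_⟩
  · by_contra! hlt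
    refine hrc (eq_zero_descending (u := fun c => Matrix.adjugate _ c r.succ) (c₁ := Fin.last k)
      ((hsum _).symm.trans (h2 _)) (Fin.le_last _) fun r' h4 _ => ⟨h3 r' _, fun h6 => ?_⟩)
    rw [(hP _).mp h6] at h4
    exact absurd hlt (not_lt.mpr h4)
  · refine adjugate_bordered_ne_zero _ _ fun u hu0 hu1 hu2 => ?_
    rw [hsum] at hu1
    funext c
    rcases le_or_gt c i.castSucc with hc | hc
    · refine eq_zero_descending (P := P) (Q := Q) hu0 hc fun r _ hr => ?_
      have hri : r < i := by simpa using hr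
      exact ⟨hu2 r (hri.trans_le hij).ne, fun h => hri.ne ((hP r).mp h)⟩
    · rcases le_or_gt c j.castSucc with hcj | hcj
      · refine eq_zero_ascending (P := P) (Q := Q) hu0 hc.le fun r _ hr => ?_
        have hrj : r < j := by simpa using hr.trans_le hcj
        exact ⟨hu2 r hrj.ne, fun h => hrj.ne ((hQ r).mp h)⟩
      · refine eq_zero_descending (P := P) (Q := Q) hu1 (Fin.le_last _) fun r hr _ => ?_
        have hrj : j < r := by simpa using hcj.trans_le hr
        exact ⟨hu2 r hrj.ne', fun h => (hij.trans_lt hrj).ne' ((hP r).mp h)⟩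

end Bordered

/-- Solving a triangular system of interpolation conditions. -/
theorem exists_solution_of_triangular {T ι K V : Type*} [Field K] [AddCommGroup V] [Module K V]
    [Fintype ι] (W : ι → Submodule K V) (ev : T → V →ₗ[K] K) (c : T → ι → K) (δ : T → ι)
    (rank : ι → ℕ) (hne : ∀ t, c t (δ t) ≠ 0)
    (hlt : ∀ t s, c t s ≠ 0 → s ≠ δ t → rank s < rank (δ t))
    (hint : ∀ s, ∀ φ : T → K, ∃ f ∈ W s, ∀ t, δ t = s → ev t f = φ t) (φ : T → K) :
    ∃ B : ι → V, (∀ s, B s ∈ W s) ∧ ∀ t, ∑ s, c t s * ev t (B s) = φ t := by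
  classical
  suffices H : ∀ n, ∃ B : ι → V, (∀ s, B s ∈ W s) ∧
      ∀ t, rank (δ t) < n → ∑ s, c t s * ev t (B s) = φ t by
    obtain ⟨B, hB, h⟩ := H (∑ s, rank s + 1)
    exact ⟨B, hB, fun t => h t (Nat.lt_succ_of_le
      (Finset.single_le_sum (fun _ _ => Nat.zero_le _) (Finset.mem_univ (δ t))))⟩
  intro n
  induction n with
  | zero => exact ⟨0, fun s => (W s).zero_mem, fun t h => absurd h (Nat.not_lt_zero _)⟩
  | succ n ih =>
    obtain ⟨B, hB, h⟩ := ih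
    choose f hfW hf using fun s => hint s fun t =>
      (φ t - ∑ s' ∈ Finset.univ.erase (δ t), c t s' * ev t (B s')) / c t (δ t)
    refine ⟨fun s => if rank s = n then f s else B s, fun s => ?_, fun t ht => ?_⟩
    · dsimp only
      split_ifs
      · exact hfW s
      · exact hB s
    · rcases Nat.lt_succ_iff_lt_or_eq.mp ht with ht | ht
      · rw [← h t ht]
        refine Finset.sum_congr rfl fun s _ => ?_
        dsimp only
        by_cases hc : c t s = 0
        · rw [hc, zero_mul, zero_mul]
        by_cases hs : s = δ t
        · rw [if_neg (by rw [hs]; omega)]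
        · rw [if_neg (by have := hlt t s hc hs; omega)]
      · dsimp only
        rw [← Finset.add_sum_erase _ _ (Finset.mem_univ (δ t)), if_pos ht, hf _ t rfl,
          mul_div_cancel₀ _ (hne t)]
        rw [Finset.sum_congr rfl, sub_add_cancel]
        intro s hs
        by_cases hc : c t s = 0
        · rw [hc, zero_mul, zero_mul]
        · rw [if_neg (by have := hlt t s hc (Finset.ne_of_mem_erase hs); omega)]

section Grid

/-- Pairwise distinct sample points. -/
noncomputable def node (i m : ℕ) : ℂ := (Nat.pair i m : ℕ)

theorem node_inj {i m i' m' : ℕ} : node i m = node i' m' ↔ i = i' ∧ m = m' := by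
  rw [node, node, Nat.cast_inj, Nat.pair_eq_pair]

/-- The first `n` sample points with index `i`. -/
noncomputable def nodes (i n : ℕ) : Finset ℂ := (Finset.range n).image (node i)

theorem mem_nodes {i n : ℕ} {a : ℂ} : a ∈ nodes i n ↔ ∃ m < n, node i m = a := by
  simp [nodes]

theorem card_nodes (i n : ℕ) : (nodes i n).card = n := by
  rw [nodes, Finset.card_image_of_injective _ fun m m' h => (node_inj.mp h).2, Finset.card_range]

theorem disjoint_nodes {i i' n n' : ℕ} (h : i ≠ i') : Disjoint (nodes i n) (nodes i' n') := by
  rw [Finset.disjoint_left]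
  intro a ha ha'
  obtain ⟨m, _, rfl⟩ := mem_nodes.mp ha
  obtain ⟨m', _, hm⟩ := mem_nodes.mp ha'
  exact h (node_inj.mp hm).1.symm

/-- The product of the linear forms vanishing at `n` sample points with index `i`. -/
noncomputable def nodeForm (v : Fin 3) (i n : ℕ) : MvPolynomial (Fin 3) ℂ :=
  ∏ a ∈ nodes i n, linForm v a

theorem nodeForm_isHomogeneous (v : Fin 3) (i n : ℕ) : (nodeForm v i n).IsHomogeneous n := by
  have := IsHomogeneous.prod (nodes i n) (fun a => linForm v a) (fun _ => 1)
    fun a _ => linForm_isHomogeneous v a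
  simpa [nodeForm, card_nodes] using this

theorem restrictLine_nodeForm (v : Fin 3) (hv : restrictLine (X v) = X v) (i n : ℕ) :
    restrictLine (nodeForm v i n) = X v ^ n := by
  rw [nodeForm, map_prod, Finset.prod_congr rfl (g := fun _ => X v), Finset.prod_const, card_nodes]
  intro a _
  rw [linForm, map_sub, map_mul, restrictLine_X_two, mul_zero, sub_zero, hv]

theorem eval_nodeForm_eq_zero {v : Fin 3} {i m i' n : ℕ} {q : Fin 3 → ℂ} (hq : q 2 = 1)
    (hv : q v = node i m) (hm : i' = i → m < n) : eval q (nodeForm v i' n) = 0 ↔ i' = i := by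
  have h : ∀ a, eval q (linForm v a) = 0 ↔ a = node i m := by
    intro a
    simp [linForm, hq, hv, sub_eq_zero, eq_comm]
  simp only [nodeForm, map_prod, Finset.prod_eq_zero_iff, h, mem_nodes]
  constructor
  · rintro ⟨a, ⟨m', _, rfl⟩, h⟩
    exact (node_inj.mp h).1
  · rintro rfl
    exact ⟨_, ⟨m, hm rfl, rfl⟩, rfl⟩

theorem map_bidiag {R S : Type*} [CommRing R] [CommRing S] (f : R → S) (hf : f 0 = 0) {k : ℕ}
    (P Q : Fin k → R) : (bidiag P Q).map f = bidiag (fun i => f (P i)) (fun i => f (Q i)) := by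
  ext i c
  simp only [bidiag, Matrix.map_apply, Matrix.of_apply]
  split_ifs <;> first | rfl | exact hf

theorem map_bordered {R S : Type*} (f : R → S) {k : ℕ} (g : Fin (k + 1) → R)
    (A : Matrix (Fin k) (Fin (k + 1)) R) :
    (bordered g A).map f = bordered (fun c => f (g c)) (A.map f) := by
  ext r c
  induction r using Fin.cases <;> rfl

theorem isFormOfDeg_bordered {k : ℕ} {N : ℕ} {g : Fin (k + 1) → MvPolynomial (Fin N) ℂ}
    {A : Matrix (Fin k) (Fin (k + 1)) (MvPolynomial (Fin N) ℂ)} {a : Fin (k + 1) → ℤ}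
    {b : Fin k → ℤ} {b₀ : ℤ} (hg : ∀ c, IsFormOfDeg (g c) (b₀ - a c))
    (hA : ∀ i c, IsFormOfDeg (A i c) (b i - a c)) (r c : Fin (k + 1)) :
    IsFormOfDeg (bordered g A r c) ((Fin.cons b₀ b : Fin (k + 1) → ℤ) r - a c) := by
  induction r using Fin.cases with
  | zero => exact hg c
  | succ r => exact hA r c

theorem IsFormOfDeg.adjugate {n N : ℕ} {A : Matrix (Fin n) (Fin n) (MvPolynomial (Fin N) ℂ)}
    {a b : Fin n → ℤ} (h : ∀ i j, IsFormOfDeg (A i j) (b i - a j)) (i j : Fin n) :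
    IsFormOfDeg (A.adjugate i j) (∑ l, b l - ∑ l, a l - (b j - a i)) := by
  rw [Matrix.adjugate_apply]
  have h1 := IsFormOfDeg.det (A := A.updateRow j (Pi.single i 1)) (a := a)
    (b := Function.update b j (a i)) fun i' j' => by
      rcases eq_or_ne i' j with rfl | hi
      · rw [Matrix.updateRow_self, Function.update_self]
        rcases eq_or_ne j' i with rfl | hj
        · simpa using isFormOfDeg_C 1
        · rw [Pi.single_eq_of_ne hj]
          exact IsFormOfDeg.zero _
      · rw [Matrix.updateRow_ne hi, Function.update_of_ne hi]
        exact h i' j'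
  convert h1 using 1
  rw [Finset.sum_update_of_mem (Finset.mem_univ j),
    ← Finset.add_sum_erase _ _ (Finset.mem_univ j), Finset.sdiff_singleton_eq_erase]
  ring

variable {k : ℕ}

/-- The bidiagonal matrix of products of linear forms in general position. -/
noncomputable def gridMatrix (p r : Fin k → ℕ) :
    Matrix (Fin k) (Fin (k + 1)) (MvPolynomial (Fin 3) ℂ) :=
  bidiag (fun i => nodeForm 0 i (p i)) (fun j => nodeForm 1 j (r j))

theorem gridMatrix_isFormOfDeg {p r : Fin k → ℕ} {a : Fin (k + 1) → ℤ} {b : Fin k → ℤ}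
    (hp : ∀ i, (p i : ℤ) = b i - a i.castSucc) (hr : ∀ i, (r i : ℤ) = b i - a i.succ)
    (i : Fin k) (c : Fin (k + 1)) : IsFormOfDeg (gridMatrix p r i c) (b i - a c) := by
  rw [gridMatrix, bidiag, Matrix.of_apply]
  split_ifs with h1 h2
  · rw [h1, ← hp, isFormOfDeg_natCast]
    exact nodeForm_isHomogeneous _ _ _
  · rw [h2, ← hr, isFormOfDeg_natCast]
    exact nodeForm_isHomogeneous _ _ _
  · exact IsFormOfDeg.zero _

theorem map_restrictLine_gridMatrix (p r : Fin k → ℕ) :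
    (gridMatrix p r).map restrictLine = bidiag (fun i => X 0 ^ p i) (fun i => X 1 ^ r i) := by
  rw [gridMatrix, map_bidiag _ (map_zero _)]
  simp only [restrictLine_nodeForm 0 restrictLine_X_zero,
    restrictLine_nodeForm 1 restrictLine_X_one]

/-- The degree of the minor of the bidiagonal matrix obtained by deleting column `c`. -/
def minorDegree (p r : Fin k → ℕ) (c : Fin (k + 1)) : ℕ :=
  ∑ l : Fin k, if l.castSucc < c then p l else r l

theorem minorDegree_eq {p r : Fin k → ℕ} {a : Fin (k + 1) → ℤ} {b : Fin k → ℤ}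
    (hp : ∀ i, (p i : ℤ) = b i - a i.castSucc) (hr : ∀ i, (r i : ℤ) = b i - a i.succ)
    (c : Fin (k + 1)) : (minorDegree p r c : ℤ) = ∑ i, b i - ∑ j, a j + a c := by
  have : ∀ l : Fin k, ((if l.castSucc < c then p l else r l : ℕ) : ℤ) =
      b l - a (c.succAbove l) := by
    intro l
    rw [Fin.succAbove]
    split_ifs
    · exact hp l
    · exact hr l
  rw [minorDegree, Nat.cast_sum, Finset.sum_congr rfl fun l _ => this l, Finset.sum_sub_distrib,
    Fin.sum_univ_succAbove a c]
  ring

theorem mixedProd_isHomogeneous (p r : Fin k → ℕ) (c : Fin (k + 1)) :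
    (mixedProd (fun i : Fin k => nodeForm 0 i (p i)) (fun j => nodeForm 1 j (r j))
      c).IsHomogeneous (minorDegree p r c) := by
  refine IsHomogeneous.prod _ _ _ fun l _ => ?_
  split_ifs
  · exact nodeForm_isHomogeneous _ _ _
  · exact nodeForm_isHomogeneous _ _ _

/-- The points at which all maximal minors of `gridMatrix p r` vanish, where `z = 1`. -/
structure GridPoint (p r : Fin k → ℕ) where
  i : Fin k
  j : Fin k
  m : ℕ
  n : ℕ
  le : i ≤ j
  m_lt : m < p i
  n_lt : n < r j

variable {p r : Fin k → ℕ}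

/-- The coordinates of a grid point. -/
noncomputable def GridPoint.coord (t : GridPoint p r) : Fin 3 → ℂ := ![node t.i t.m, node t.j t.n, 1]

theorem GridPoint.exists_form_eval (p r : Fin k → ℕ) : ∃ N : ℕ, ∀ d : ℕ, N ≤ d →
    ∀ φ : GridPoint p r → ℂ, ∃ f : MvPolynomial (Fin 3) ℂ, IsFormOfDeg f d ∧
      ∀ t, eval t.coord f = φ t := by
  classical
  set N : ℕ := ∑ i : Fin k, (Nat.pair i (p i) + Nat.pair i (r i)) with hN
  have hle : ∀ i : Fin k, Nat.pair i (p i) + Nat.pair i (r i) ≤ N := fun i =>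
    Finset.single_le_sum (f := fun i : Fin k => Nat.pair i (p i) + Nat.pair i (r i))
      (fun _ _ => Nat.zero_le _) (Finset.mem_univ i)
  refine ⟨2 * N, fun d hd φ => ?_⟩
  obtain ⟨f, hf, hfe⟩ := exists_form_eval_eq (fun n => (n : ℂ)) (fun n => (n : ℂ)) N N
    Nat.cast_injective.injOn Nat.cast_injective.injOn
    (fun x y => if h : ∃ t : GridPoint p r, Nat.pair t.i t.m = x ∧ Nat.pair t.j t.n = y then
      φ h.choose else 0) (d + 1)
  refine ⟨f, by simpa using hf, fun t => ?_⟩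
  have h1 : Nat.pair t.i t.m < N :=
    (Nat.pair_lt_pair_right _ t.m_lt).trans_le ((Nat.le_add_right _ _).trans (hle t.i))
  have h2 : Nat.pair t.j t.n < N :=
    (Nat.pair_lt_pair_right _ t.n_lt).trans_le ((Nat.le_add_left _ _).trans (hle t.j))
  have h3 : ∃ t' : GridPoint p r, Nat.pair t'.i t'.m = Nat.pair t.i t.m ∧
      Nat.pair t'.j t'.n = Nat.pair t.j t.n := ⟨t, rfl, rfl⟩
  refine (hfe _ h1 _ h2 (by omega)).trans ((dif_pos h3).trans (congrArg φ ?_))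
  generalize h3.choose = t', h3.choose_spec = h4
  obtain ⟨h4, h5⟩ := h4
  rw [Nat.pair_eq_pair] at h4 h5
  obtain ⟨i, j, m, n, _, _, _⟩ := t
  obtain ⟨i', j', m', n', _, _, _⟩ := t'
  simp only [Fin.val_inj] at h4 h5
  obtain ⟨rfl, rfl⟩ := h4
  obtain ⟨rfl, rfl⟩ := h5
  rfl

/-- The grid points at which the upper entries of the matrix are used for interpolation. -/
def GridPoint.IsUpper (a : Fin (k + 1) → ℤ) (b : Fin k → ℤ) (t : GridPoint p r) : Prop :=
  ((t.m + t.n : ℕ) : ℤ) < b t.i - a t.j.succ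

open Classical in
/-- The matrix entry used for interpolation at a given grid point. -/
noncomputable def GridPoint.entry (a : Fin (k + 1) → ℤ) (b : Fin k → ℤ) (t : GridPoint p r) :
    Fin k × Fin (k + 1) :=
  if t.IsUpper a b then (t.i, t.j.succ) else (t.j, t.i.castSucc)

theorem IsFormOfDeg.of_toNat {N : ℕ} {f : MvPolynomial (Fin N) ℂ} {m : ℤ}
    (h : IsFormOfDeg f ((m.toNat : ℤ) - 1)) : IsFormOfDeg f (m - 1) := by
  rcases lt_or_ge m 0 with hm | hm
  · rw [Int.toNat_of_nonpos hm.le, IsFormOfDeg, if_pos (by norm_num)] at h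
    rw [h]
    exact IsFormOfDeg.zero _
  · rwa [Int.toNat_of_nonneg hm] at h

theorem GridPoint.exists_form_eval_of_entry_eq {a : Fin (k + 1) → ℤ} {b : Fin k → ℤ}
    (hp : ∀ i, (p i : ℤ) = b i - a i.castSucc) (hr : ∀ i, (r i : ℤ) = b i - a i.succ)
    (s : Fin k × Fin (k + 1)) (φ : GridPoint p r → ℂ) :
    ∃ f ∈ formSubmodule 3 (b s.1 - a s.2 - 1),
      ∀ t : GridPoint p r, t.entry a b = s → eval t.coord f = φ t := by
  classical
  obtain ⟨i, c⟩ := s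
  rcases lt_or_ge i.castSucc c with hc | hc
  · obtain ⟨j, rfl⟩ := Fin.exists_succ_eq.mpr (Fin.ne_zero_of_lt hc)
    have hij : i ≤ j := Fin.castSucc_lt_succ_iff.mp hc
    obtain ⟨f, hf, hfe⟩ := exists_form_eval_eq (node i) (node j) (p i) (r j)
      (fun m _ m' _ h => (node_inj.mp h).2) (fun m _ m' _ h => (node_inj.mp h).2)
      (fun m n => if h : m < p i ∧ n < r j then φ ⟨i, j, m, n, hij, h.1, h.2⟩ else 0)
      (b i - a j.succ).toNat
    refine ⟨f, hf.of_toNat, fun t ht => ?_⟩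
    obtain ⟨i', j', m, n, hij', hm, hn⟩ := t
    by_cases h : GridPoint.IsUpper a b ⟨i', j', m, n, hij', hm, hn⟩
    · rw [GridPoint.entry, if_pos h] at ht
      simp only [GridPoint.IsUpper] at h
      simp only [Prod.mk.injEq, Fin.succ_inj] at ht
      obtain ⟨rfl, rfl⟩ := ht
      exact (hfe m hm n hn (by omega)).trans (dif_pos ⟨hm, hn⟩)
    · rw [GridPoint.entry, if_neg h] at ht
      simp only [Prod.mk.injEq] at ht
      obtain ⟨rfl, h2⟩ := ht
      rw [← h2, Fin.castSucc_lt_castSucc_iff] at hc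
      exact absurd hij' (not_le.mpr hc)
  · obtain ⟨j, rfl⟩ := Fin.exists_castSucc_eq.mpr
      (Fin.ne_last_of_lt (hc.trans_lt (Fin.castSucc_lt_last i)))
    have hij : j ≤ i := Fin.castSucc_le_castSucc_iff.mp hc
    obtain ⟨f, hf, hfe⟩ := exists_form_eval_eq (fun m => node j (p j - 1 - m))
      (fun n => node i (r i - 1 - n)) (p j) (r i)
      (fun m hm m' hm' h => by
        have := (node_inj.mp h).2
        rw [Set.mem_Iio] at hm hm'
        omega)
      (fun m hm m' hm' h => by
        have := (node_inj.mp h).2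
        rw [Set.mem_Iio] at hm hm'
        omega)
      (fun m n => if h : p j - 1 - m < p j ∧ r i - 1 - n < r i then
        φ ⟨j, i, p j - 1 - m, r i - 1 - n, hij, h.1, h.2⟩ else 0)
      (b i - a j.castSucc).toNat
    refine ⟨f, hf.of_toNat, fun t ht => ?_⟩
    obtain ⟨i', j', m, n, hij', hm, hn⟩ := t
    by_cases h : GridPoint.IsUpper a b ⟨i', j', m, n, hij', hm, hn⟩
    · rw [GridPoint.entry, if_pos h] at ht
      simp only [Prod.mk.injEq] at ht
      obtain ⟨rfl, h2⟩ := ht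
      rw [← h2, Fin.succ_le_castSucc_iff] at hc
      exact absurd hij' (not_le.mpr hc)
    · rw [GridPoint.entry, if_neg h] at ht
      simp only [GridPoint.IsUpper] at h
      simp only [Prod.mk.injEq, Fin.castSucc_inj] at ht
      obtain ⟨rfl, rfl⟩ := ht
      have h1 := hp i'
      have h2 := hr j'
      have h3 := hfe (p i' - 1 - m) (by omega) (r j' - 1 - n) (by omega) (by omega)
      have hm' : p i' - 1 - (p i' - 1 - m) = m := by omega
      have hn' : r j' - 1 - (r j' - 1 - n) = n := by omega
      simp only [hm', hn'] at h3
      exact h3.trans (dif_pos ⟨hm, hn⟩)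

open Classical in
theorem exists_borderedRow {a : Fin (k + 1) → ℤ} {b : Fin k → ℤ}
    (hp : ∀ i, (p i : ℤ) = b i - a i.castSucc) (hr : ∀ i, (r i : ℤ) = b i - a i.succ) :
    ∃ d₀ : ℕ, ∀ d : ℕ, d₀ ≤ d → ∃ g : Fin (k + 1) → MvPolynomial (Fin 3) ℂ,
      (∀ c, IsFormOfDeg (g c) (d - ∑ i, b i + ∑ j, a j - a c)) ∧
      ∀ (t : GridPoint p r) (c), eval t.coord (g c) =
        (Pi.single (if t.IsUpper a b then 0 else Fin.last k) 1 : Fin (k + 1) → ℂ) c := by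
  obtain ⟨N, hN⟩ := GridPoint.exists_form_eval p r
  refine ⟨N + ∑ c, minorDegree p r c, fun d hd => ?_⟩
  have hle : ∀ c, minorDegree p r c ≤ ∑ c, minorDegree p r c := fun c =>
    Finset.single_le_sum (fun _ _ => Nat.zero_le _) (Finset.mem_univ c)
  choose g hg hge using fun c => hN (d - minorDegree p r c) (by have := hle c; omega) fun t =>
    (Pi.single (if t.IsUpper a b then 0 else Fin.last k) 1 : Fin (k + 1) → ℂ) c
  refine ⟨g, fun c => ?_, fun t c => hge c t⟩
  convert hg c using 1
  rw [Nat.cast_sub (by have := hle c; omega), minorDegree_eq hp hr]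
  ring

/-- A weight on matrix entries making the interpolation conditions triangular. -/
def entryRank (s : Fin k × Fin (k + 1)) : ℕ :=
  if (s.2 : ℕ) ≤ s.1 then s.1 + s.2 else 2 * k + 1 - (s.1 + s.2)

open Classical in
theorem GridPoint.adjugate_entry {a : Fin (k + 1) → ℤ} {b : Fin k → ℤ}
    {g : Fin (k + 1) → MvPolynomial (Fin 3) ℂ} (t : GridPoint p r)
    (hg : ∀ c, eval t.coord (g c) =
      (Pi.single (if t.IsUpper a b then 0 else Fin.last k) 1 : Fin (k + 1) → ℂ) c) :
    eval t.coord ((bordered g (gridMatrix p r)).adjugate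
      (t.entry a b).2 (t.entry a b).1.succ) ≠ 0 ∧
    ∀ s : Fin k × Fin (k + 1),
      eval t.coord ((bordered g (gridMatrix p r)).adjugate s.2 s.1.succ) ≠ 0 →
        s ≠ t.entry a b → entryRank s < entryRank (t.entry a b) := by
  have hmap : ∀ c c', eval t.coord ((bordered g (gridMatrix p r)).adjugate c c') =
      (bordered (Pi.single (if t.IsUpper a b then 0 else Fin.last k) 1)
        (bidiag (fun i => eval t.coord (nodeForm 0 i (p i)))
          fun j => eval t.coord (nodeForm 1 j (r j)))).adjugate c c' := by
    intro c c'
    have h1 := congrFun (congrFun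
      ((eval t.coord).map_adjugate (bordered g (gridMatrix p r))) c) c'
    rw [RingHom.mapMatrix_apply, RingHom.mapMatrix_apply, Matrix.map_apply] at h1
    rw [h1, map_bordered, gridMatrix, map_bidiag _ (map_zero _)]
    simp only [hg]
  have hP : ∀ l : Fin k, eval t.coord (nodeForm 0 l (p l)) = 0 ↔ l = t.i := by
    intro l
    rw [eval_nodeForm_eq_zero (i := t.i) (m := t.m) rfl rfl fun h => by rw [Fin.ext h]; exact t.m_lt,
      Fin.val_inj]
  have hQ : ∀ l : Fin k, eval t.coord (nodeForm 1 l (r l)) = 0 ↔ l = t.j := by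
    intro l
    rw [eval_nodeForm_eq_zero (i := t.j) (m := t.n) rfl rfl fun h => by rw [Fin.ext h]; exact t.n_lt,
      Fin.val_inj]
  simp only [hmap]
  have hij : (t.i : ℕ) ≤ t.j := t.le
  by_cases h : t.IsUpper a b
  · obtain ⟨h1, h2⟩ := adjugate_bordered_single_zero t.le hP hQ
    simp only [GridPoint.entry, if_pos h]
    refine ⟨h2, fun s hs hne => ?_⟩
    obtain ⟨h3, h4, h5⟩ := h1 s.1 s.2 hs
    have h3' : (t.i : ℕ) ≤ s.1 := h3
    have h4' : (s.1 : ℕ) ≤ t.j := h4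
    have h5' : (t.j : ℕ) + 1 ≤ s.2 := h5
    have h6 := s.2.2
    have h7 : ¬ ((s.1 : ℕ) = t.i ∧ (s.2 : ℕ) = t.j + 1) := fun h =>
      hne (Prod.ext (Fin.ext h.1) (Fin.ext h.2))
    simp only [entryRank, Fin.val_succ]
    rw [if_neg (by omega), if_neg (by omega)]
    omega
  · obtain ⟨h1, h2⟩ := adjugate_bordered_single_last t.le hP hQ
    simp only [GridPoint.entry, if_neg h]
    refine ⟨h2, fun s hs hne => ?_⟩
    obtain ⟨h3, h4, h5⟩ := h1 s.1 s.2 hs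
    have h3' : (t.i : ℕ) ≤ s.1 := h3
    have h4' : (s.1 : ℕ) ≤ t.j := h4
    have h5' : (s.2 : ℕ) ≤ t.i := h5
    have h7 : ¬ ((s.1 : ℕ) = t.j ∧ (s.2 : ℕ) = t.i) := fun h =>
      hne (Prod.ext (Fin.ext h.1) (Fin.ext h.2))
    simp only [entryRank, Fin.val_castSucc]
    rw [if_pos (by omega), if_pos (by omega)]
    omega

open Classical in
theorem exists_adjugate_mul_eq {a : Fin (k + 1) → ℤ} {b : Fin k → ℤ}
    (hp : ∀ i, (p i : ℤ) = b i - a i.castSucc) (hr : ∀ i, (r i : ℤ) = b i - a i.succ) {d : ℕ}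
    {g : Fin (k + 1) → MvPolynomial (Fin 3) ℂ}
    (hg : ∀ c, IsFormOfDeg (g c) (d - ∑ i, b i + ∑ j, a j - a c))
    (hge : ∀ (t : GridPoint p r) (c), eval t.coord (g c) =
      (Pi.single (if t.IsUpper a b then 0 else Fin.last k) 1 : Fin (k + 1) → ℂ) c)
    {G : MvPolynomial (Fin 3) ℂ} (hG : G.IsHomogeneous d) :
    ∃ (u : Fin (k + 1) → MvPolynomial (Fin 3) ℂ) (B : Fin k × Fin (k + 1) → MvPolynomial (Fin 3) ℂ),
      (∀ c, IsFormOfDeg (u c) (d - ∑ i, b i + ∑ j, a j - a c)) ∧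
      (∀ s, IsFormOfDeg (B s) (b s.1 - a s.2 - 1)) ∧
      ∑ c, ((bordered g (gridMatrix p r)).adjugate c 0 * u c +
        ∑ i : Fin k, (bordered g (gridMatrix p r)).adjugate c i.succ * (X 2 * B (i, c))) = G := by
  set M := bordered g (gridMatrix p r) with hM
  obtain ⟨B, hB, hBe⟩ := exists_solution_of_triangular
    (fun s : Fin k × Fin (k + 1) => formSubmodule 3 (b s.1 - a s.2 - 1))
    (fun t : GridPoint p r => (aeval t.coord).toLinearMap)
    (fun t s => eval t.coord (M.adjugate s.2 s.1.succ)) (GridPoint.entry a b) entryRank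
    (fun t => (t.adjugate_entry (hge t)).1) (fun t => (t.adjugate_entry (hge t)).2)
    (fun s φ => by
      simpa [aeval_eq_eval] using GridPoint.exists_form_eval_of_entry_eq hp hr s φ)
    (fun t => eval t.coord G)
  have hadj : ∀ (c : Fin (k + 1)) (i : Fin k),
      IsFormOfDeg (M.adjugate c i.succ) (d - (b i - a c)) := by
    intro c i
    have := IsFormOfDeg.adjugate
      (isFormOfDeg_bordered hg (gridMatrix_isFormOfDeg hp hr)) c i.succ
    rw [Fin.sum_univ_succ, Fin.cons_zero] at this
    simp only [Fin.cons_succ] at this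
    convert this using 1
    ring
  set f := G - ∑ c, ∑ i : Fin k, M.adjugate c i.succ * (X 2 * B (i, c)) with hf
  have hsum : IsFormOfDeg (∑ c, ∑ i : Fin k, M.adjugate c i.succ * (X 2 * B (i, c))) (d : ℤ) := by
    refine IsFormOfDeg.sum _ _ fun c _ => IsFormOfDeg.sum _ _ fun i _ => ?_
    have hX : IsFormOfDeg (X 2 : MvPolynomial (Fin 3) ℂ) ((1 : ℕ) : ℤ) :=
      isFormOfDeg_natCast.mpr (isHomogeneous_X _ _)
    convert (hadj c i).mul (hX.mul (hB (i, c))) using 1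
    push_cast
    ring
  have hfd : f.IsHomogeneous d := hG.sub (isFormOfDeg_natCast.mp hsum)
  have hfe : ∀ t : GridPoint p r, eval t.coord f = 0 := by
    intro t
    have h1 := hBe t
    rw [Fintype.sum_prod_type_right] at h1
    rw [hf, map_sub, ← h1, sub_eq_zero]
    simp [aeval_eq_eval, GridPoint.coord]
  obtain ⟨v, hv⟩ := exists_eq_sum_mixedProd (fun i : Fin k => nodes i (p i))
    (fun j : Fin k => nodes j (r j)) (fun i j h => disjoint_nodes (Fin.val_ne_of_ne h))
    (fun i j h => disjoint_nodes (Fin.val_ne_of_ne h)) f fun i j hij x hx y hy => by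
      obtain ⟨m, hm, rfl⟩ := mem_nodes.mp hx
      obtain ⟨n, hn, rfl⟩ := mem_nodes.mp hy
      rw [evalLine_of_isHomogeneous hfd]
      have : eval ![node i m, node j n, 1] f = 0 := hfe ⟨i, j, m, n, hij, hm, hn⟩
      rw [this, map_zero, zero_mul]
  obtain ⟨v', hv', hv'f⟩ := exists_form_coeff _ (minorDegree p r)
    (mixedProd_isHomogeneous p r) hfd v hv
  refine ⟨fun c => (-1) ^ (c : ℕ) * v' c, B, fun c => ?_, hB, ?_⟩
  · have h1 := (isFormOfDeg_C ((-1) ^ (c : ℕ))).mul (hv' c)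
    rw [minorDegree_eq hp hr] at h1
    convert h1 using 1
    · simp
    · ring
  · rw [Finset.sum_add_distrib, ← eq_sub_iff_add_eq, ← hf, hv'f]
    refine Finset.sum_congr rfl fun c _ => ?_
    rw [hM, adjugate_bordered_zero, gridMatrix, det_bidiag_submatrix]
    have : ((-1) ^ (c : ℕ) * (-1) ^ (c : ℕ) : MvPolynomial (Fin 3) ℂ) = 1 := by
      rw [← mul_pow]
      simp
    linear_combination (v' c * mixedProd (fun i : Fin k => nodeForm 0 i (p i))
      (fun j => nodeForm 1 j (r j)) c) * this

end Grid

theorem exists_natCast_eq_sub {k : ℕ} (Q : Matrix (Fin k) (Fin (k + 1)) ℤ)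
    (hQ : IsHomogMatrix Q) (hk : 0 < k) :
    ∃ (a : Fin (k + 1) → ℤ) (b : Fin k → ℤ), ∀ i c, Q i c = b i - a c := by
  refine ⟨fun c => Q ⟨0, hk⟩ 0 - Q ⟨0, hk⟩ c, fun i => Q i 0, fun i c => ?_⟩
  rcases eq_or_ne i ⟨0, hk⟩ with rfl | hi
  · ring
  rcases eq_or_ne c 0 with rfl | hc
  · ring
  have := hQ ⟨0, hk⟩ i 0 c (Fin.lt_def.mpr (Nat.pos_of_ne_zero fun h => hi (Fin.ext h)))
    (Fin.pos_of_ne_zero hc)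
  linarith

/-- The weights of the rows in the deformation: only rows other than the first move by multiples
of `X 2`. -/
noncomputable def rowWeight {k : ℕ} : Fin (k + 1) → MvPolynomial (Fin 3) ℂ :=
  Fin.cons 1 fun _ => X 2

/-- The determinant of the deformation of `M` as a polynomial in its parameters. -/
noncomputable def deformationDet {k : ℕ}
    (M : Matrix (Fin (k + 1)) (Fin (k + 1)) (MvPolynomial (Fin 3) ℂ)) :
    MvPolynomial (Fin (k + 1) × Fin (k + 1)) (MvPolynomial (Fin 3) ℂ) :=
  (Matrix.of fun i c => C (M i c) + C (rowWeight i) * X (i, c)).det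

theorem eval_deformationDet {k : ℕ} (g : Fin (k + 1) → MvPolynomial (Fin 3) ℂ)
    (A : Matrix (Fin k) (Fin (k + 1)) (MvPolynomial (Fin 3) ℂ))
    (u : Fin (k + 1) × Fin (k + 1) → MvPolynomial (Fin 3) ℂ) :
    eval u (deformationDet (bordered g A)) =
      (bordered (fun c => g c + u (0, c))
        (A + Matrix.of fun i c => X 2 * u (i.succ, c))).det := by
  rw [deformationDet, RingHom.map_det]
  congr 1
  ext1 i c
  induction i using Fin.cases <;> simp [rowWeight]

theorem coeff_one_deformationDet {k : ℕ}
    (M : Matrix (Fin (k + 1)) (Fin (k + 1)) (MvPolynomial (Fin 3) ℂ))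
    (u : Fin (k + 1) × Fin (k + 1) → MvPolynomial (Fin 3) ℂ) :
    (eval₂ Polynomial.C (fun i => Polynomial.X * Polynomial.C (u i))
      (deformationDet M)).coeff 1 =
      ∑ c, (M.adjugate c 0 * u (0, c) +
        ∑ i : Fin k, M.adjugate c i.succ * (X 2 * u (i.succ, c))) := by
  have h : (eval₂Hom Polynomial.C (fun i => Polynomial.X * Polynomial.C (u i))).mapMatrix
      (Matrix.of fun i c => C (M i c) + C (rowWeight i) * X (i, c)) =
      Matrix.of fun i c => Polynomial.C (M i c) +
        Polynomial.C (rowWeight i * u (i, c)) * Polynomial.X := by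
    ext1 i c
    simp
    ring
  rw [deformationDet, ← coe_eval₂Hom, RingHom.map_det, h, coeff_one_det]
  refine Finset.sum_congr rfl fun c _ => ?_
  have h0 : (Matrix.of fun i c => Polynomial.C (M i c) +
      Polynomial.C (rowWeight i * u (i, c)) * Polynomial.X).map (fun f => f.coeff 0) = M := by
    ext1 i c
    simp
  rw [h0, Fin.sum_univ_succ]
  simp [rowWeight]

theorem isZeroDimIdeal_minorsIdeal_gridMatrix_add {k : ℕ} {p r : Fin k → ℕ}
    {a : Fin (k + 1) → ℤ} {b : Fin k → ℤ}
    (hr : ∀ i, (r i : ℤ) = b i - a i.succ)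
    (hpos : ∃ i, 0 < p i ∧ 0 < r i) {B : Fin k → Fin (k + 1) → MvPolynomial (Fin 3) ℂ}
    (hB : ∀ i c, IsFormOfDeg (gridMatrix p r i c + X 2 * B i c) (b i - a c)) :
    IsZeroDimIdeal (minorsIdeal (gridMatrix p r + Matrix.of fun i c => X 2 * B i c)) := by
  refine isZeroDimIdeal_minorsIdeal _ p r ?_ hpos ?_
  · rw [← map_restrictLine_gridMatrix]
    ext1 i c
    simp
  · have h : IsFormOfDeg ((gridMatrix p r + Matrix.of fun i c => X 2 * B i c).submatrix id
        (0 : Fin (k + 1)).succAbove).det ((∑ i, r i : ℕ) : ℤ) := by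
      have := IsFormOfDeg.det (A := (gridMatrix p r + Matrix.of fun i c => X 2 * B i c).submatrix
        id (0 : Fin (k + 1)).succAbove) (a := fun j => a j.succ) (b := b) fun i j => hB i j.succ
      rw [← Finset.sum_sub_distrib, ← Finset.sum_congr rfl fun i _ => hr i] at this
      rwa [Nat.cast_sum]
    exact (isFormOfDeg_natCast.mp h).totalDegree_le

/-- (Corollary 6.3, the asymptotic principle.)  For any well-ordered homogeneous
`k×(k+1)` integer matrix `Q` with non-negative diagonal entries, at least one of which
is positive (i.e. any possible dHB matrix of a zero-dimensional subscheme of `ℙ²`),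
there is `d₀` such that for every `d ≥ d₀` a general plane curve of degree `d` contains
a zero-dimensional subscheme with dHB matrix `Q`. -/
theorem stmt_16 {k : ℕ} (Q : Matrix (Fin k) (Fin (k + 1)) ℤ)
    (hQ : IsHomogMatrix Q) (hQw : WellOrderedMatrix Q)
    (hdiag : ∀ i : Fin k, 0 ≤ Q i i.castSucc)
    (hmax : ∃ i : Fin k, 0 < Q i i.castSucc) :
    ∃ d₀ : ℤ, ∀ d : ℤ, d₀ ≤ d →
      GeneralForm 3 d (fun F =>
        ∃ A : Matrix (Fin k) (Fin (k + 1)) (MvPolynomial (Fin 3) ℂ),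
          HasDegMatrix A Q ∧ IsZeroDimIdeal (minorsIdeal A) ∧ F ∈ minorsIdeal A) := by
  obtain ⟨i₀, hi₀⟩ := hmax
  obtain ⟨a, b, hab⟩ := exists_natCast_eq_sub Q hQ i₀.pos
  have hle : ∀ i : Fin k, Q i i.castSucc ≤ Q i i.succ := fun i =>
    hQw.2 i _ _ Fin.castSucc_lt_succ.le
  obtain ⟨p, hp⟩ : ∃ p : Fin k → ℕ, ∀ i, (p i : ℤ) = b i - a i.castSucc :=
    ⟨fun i => (Q i i.castSucc).toNat, fun i => by rw [Int.toNat_of_nonneg (hdiag i), hab]⟩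
  obtain ⟨r, hr⟩ : ∃ r : Fin k → ℕ, ∀ i, (r i : ℤ) = b i - a i.succ :=
    ⟨fun i => (Q i i.succ).toNat, fun i => by
      rw [Int.toNat_of_nonneg ((hdiag i).trans (hle i)), hab]⟩
  have hpos : ∃ i, 0 < p i ∧ 0 < r i :=
    ⟨i₀, by have := hle i₀; have := hp i₀; have := hr i₀; simp only [hab] at *; omega⟩
  obtain ⟨d₀, hd₀⟩ := exists_borderedRow hp hr
  refine ⟨d₀, fun d hd => ?_⟩
  lift d to ℕ using (Int.natCast_nonneg d₀).trans hd
  obtain ⟨g, hg, hge⟩ := hd₀ d (by exact_mod_cast hd)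
  let deg : Fin (k + 1) × Fin (k + 1) → ℤ := fun s =>
    (Fin.cons (d - ∑ i, b i + ∑ j, a j) fun i => b i - 1 : Fin (k + 1) → ℤ) s.1 - a s.2
  have hrow : ∀ u ∈ Submodule.pi Set.univ fun s => formSubmodule 3 (deg s), ∀ c,
      IsFormOfDeg (g c + u (0, c)) (d - ∑ i, b i + ∑ j, a j - a c) := fun u hu c =>
    (hg c).add (hu (0, c) (Set.mem_univ _))
  have hmat : ∀ u ∈ Submodule.pi Set.univ fun s => formSubmodule 3 (deg s), ∀ i c,
      IsFormOfDeg (gridMatrix p r i c + X 2 * u (i.succ, c)) (b i - a c) := by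
    intro u hu i c
    have hX : IsFormOfDeg (X 2 : MvPolynomial (Fin 3) ℂ) ((1 : ℕ) : ℤ) :=
      isFormOfDeg_natCast.mpr (isHomogeneous_X _ _)
    refine (gridMatrix_isFormOfDeg hp hr i c).add ?_
    convert hX.mul (hu (i.succ, c) (Set.mem_univ _)) using 1
    simp [deg]
    ring
  refine generalForm_of_submersion (Submodule.pi Set.univ fun s => formSubmodule 3 (deg s))
    (deformationDet (bordered g (gridMatrix p r))) (fun u hu => ?_) (fun u hu => ?_) fun G hG => ?_
  · rw [eval_deformationDet, ← isFormOfDeg_natCast]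
    have := IsFormOfDeg.det (isFormOfDeg_bordered (hrow u hu)
      (A := gridMatrix p r + Matrix.of fun i c => X 2 * u (i.succ, c)) (hmat u hu))
    rw [Fin.sum_univ_succ, Fin.cons_zero] at this
    simp only [Fin.cons_succ] at this
    convert this using 1
    ring
  · have hz := isZeroDimIdeal_minorsIdeal_gridMatrix_add (B := fun i c => u (i.succ, c)) hr hpos
      (hmat u hu)
    rw [eval_deformationDet]
    generalize hA : gridMatrix p r + Matrix.of (fun i c => X 2 * u (i.succ, c)) = A at hz ⊢
    refine ⟨A, fun i c => ?_, hz, ?_⟩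
    · rw [hab, ← hA]
      exact hmat u hu i c
    · rw [det_bordered]
      exact Ideal.sum_mem _ fun c _ => Ideal.mul_mem_left _ _ (Ideal.subset_span ⟨c, rfl⟩)
  · obtain ⟨u, B, hu, hB, h⟩ := exists_adjugate_mul_eq hp hr hg hge hG
    let u' : Fin (k + 1) × Fin (k + 1) → MvPolynomial (Fin 3) ℂ := fun s =>
      (Fin.cons (u s.2) fun i => B (i, s.2) : Fin (k + 1) → MvPolynomial (Fin 3) ℂ) s.1
    refine ⟨u', fun s _ => ?_, (coeff_one_deformationDet _ _).trans h⟩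
    obtain ⟨i, c⟩ := s
    change IsFormOfDeg (u' (i, c)) (deg (i, c))
    induction i using Fin.cases with
    | zero => exact hu c
    | succ i =>
      rw [show deg (i.succ, c) = b i - a c - 1 from sub_right_comm _ _ _]
      exact hB (i, c)
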